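/- Let F_q be a finite field with q elements. For every ε > 0 there exists δ > 0 such that for all sufficiently large q and all sets F, G, H ⊆ F_q with |F| ≥ q^{1/2+ε} and |G||H| ≥ q^{2-δ}, the set E(F,G,H) of λ ∈ F_q for which f + gh = λ has no solution (f,g,h) ∈ F×G×H satisfies |E(F,G,H)| = O(q^ε). -/

import Mathlib

open Finset
open Polynomial in
/-- Hasse derivatives of a power `f^N`, multiplied by `f^b`, are divisible by `f^N`. -/
theorem hasse_pow_aux {K : Type*} [Field K] (f : K[X]) (N b : ℕ) :
    ∃ s : K[X], f ^ b * hasseDeriv b (f ^ N) = f ^ N * s ∧ s.natDegree ≤ b * f.natDegree := by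
  induction N generalizing b with
  | zero =>
    rcases Nat.eq_zero_or_pos b with rfl | hb
    · exact ⟨1, by simp, by simp⟩
    · refine ⟨0, ?_, by simp⟩
      rw [pow_zero, hasseDeriv_apply_one b hb]; simp
  | succ N ih =>
    have h1 : ∀ a : ℕ, ∃ t : K[X], f ^ a * hasseDeriv a f = f * t ∧
        t.natDegree ≤ a * f.natDegree := by
      intro a
      rcases a with _ | a
      · exact ⟨1, by simp, by simp⟩
      · refine ⟨f ^ a * hasseDeriv (a+1) f, by ring, ?_⟩
        refine natDegree_mul_le.trans ?_
        have h2 := natDegree_hasseDeriv_le f (a+1)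
        have h3 : (f ^ a).natDegree ≤ a * f.natDegree := natDegree_pow_le
        have : (a+1) * f.natDegree = a * f.natDegree + f.natDegree := by ring
        omega
    choose t ht ht' using h1
    choose s hs hs' using ih
    refine ⟨∑ p ∈ antidiagonal b, t p.1 * s p.2, ?_, ?_⟩
    · rw [pow_succ', hasseDeriv_mul, Finset.mul_sum, Finset.mul_sum]
      refine Finset.sum_congr rfl fun p hp => ?_
      have hp' := Finset.HasAntidiagonal.mem_antidiagonal.1 hp
      rw [← hp', pow_add]
      linear_combination (f ^ p.2 * hasseDeriv p.2 (f^N)) * ht p.1 + f * t p.1 * hs p.2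
    · refine natDegree_sum_le_of_forall_le _ _ fun p hp => ?_
      have hp' := Finset.HasAntidiagonal.mem_antidiagonal.1 hp
      refine natDegree_mul_le.trans ?_
      have := ht' p.1
      have := hs' p.2
      rw [← hp', add_mul]; omega

open Polynomial in
theorem hasse_eval_X_sub_C_pow {K : Type*} [Field K] [Fintype K] (l x : K) (j b : ℕ) (hb : 0 < b)
    (hb' : b < Fintype.card K) :
    (hasseDeriv b ((X - C l) ^ (Fintype.card K * j))).eval x = 0 := by
  have h0 : taylor x ((X - C l) ^ (Fintype.card K * j) : K[X]) =
      expand K (Fintype.card K) ((X + C (x - l))^j) := by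
    rw [taylor_pow, pow_mul, map_pow, FiniteField.expand_card]
    congr 2
    simp [taylor_apply]; ring
  rw [← taylor_coeff, h0, coeff_expand Fintype.card_pos, if_neg]
  exact fun h => absurd (Nat.le_of_dvd hb h) (by omega)

open Polynomial in
theorem stepanov_nonzero {K : Type*} [Field K] {ι : Type*} [Fintype ι] (l : K) (c : ι → K)
    (h : ι → K[X]) (v : ι → ℕ) (hv : Function.Injective v) (hh : ∀ t, (h t).eval l ≠ 0)
    (hc : c ≠ 0) : ∑ t, C (c t) * (h t * (X - C l) ^ v t) ≠ 0 := by
  classical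
  intro h0
  obtain ⟨t1, ht1⟩ := Function.ne_iff.1 hc
  obtain ⟨t0, ht0, hmin⟩ := Finset.exists_min_image (univ.filter fun t => c t ≠ 0) v
    ⟨t1, by simpa using ht1⟩
  have ht0' : c t0 ≠ 0 := by simpa using ht0
  rw [← Finset.add_sum_erase _ _ (mem_univ t0)] at h0
  have hd : (X - C l) ^ (v t0 + 1) ∣ ∑ t ∈ univ.erase t0, C (c t) * (h t * (X - C l) ^ v t) := by
    refine Finset.dvd_sum fun t ht => ?_
    by_cases hct : c t = 0
    · simp [hct]
    have h1 := hmin t (by simpa using hct)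
    have h2 : v t0 ≠ v t := fun hh => (Finset.ne_of_mem_erase ht) (hv hh).symm
    exact Dvd.dvd.mul_left (Dvd.dvd.mul_left (pow_dvd_pow _ (by omega)) _) _
  have hd2 : (X - C l) ^ (v t0 + 1) ∣ C (c t0) * (h t0 * (X - C l) ^ v t0) := by
    rw [eq_neg_of_add_eq_zero_left h0]; exact (dvd_neg).2 hd
  have hd3 : (X - C l) ∣ C (c t0) * h t0 := by
    have hne : ((X - C l) ^ v t0) ≠ 0 := pow_ne_zero _ (X_sub_C_ne_zero l)
    rw [pow_succ', ← mul_assoc] at hd2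
    exact (mul_dvd_mul_iff_right hne).1 hd2
  rw [dvd_iff_isRoot] at hd3
  simp [ht0', hh t0] at hd3

open Polynomial in
/-- The method of Stepanov. -/
theorem stepanov {K : Type*} [Field K] [Fintype K] [DecidableEq K] (f h : K[X]) (l a : K)
    (hf : f = (X - C l) * h) (hl : h.eval l ≠ 0) (d e J M : ℕ)
    (hde : d * e + 1 = Fintype.card K) (hM : M ≤ Fintype.card K)
    (hcount : M * (e + J + M * f.natDegree) < d * J * e) :
    #{x : K | f.eval x ≠ 0 ∧ f.eval x ^ e = a} * M ≤
      Fintype.card K * (J + f.natDegree) := by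
  set m := f.natDegree with hm
  set Q := Fintype.card K with hQ
  choose s hs hs' using hasse_pow_aux f
  let r : (Fin d × Fin J × Fin e → K) → Fin d → Fin J → K[X] := fun c i j =>
    ∑ n : Fin e, C (c (i, j, n)) * (X - C l) ^ (n : ℕ)
  let S : K[X] → ℕ → ℕ → K[X] := fun r N k => ∑ p ∈ HasAntidiagonal.antidiagonal k,
    f ^ p.1 * hasseDeriv p.1 r * s N p.2
  let T : (Fin d × Fin J × Fin e → K) → ℕ → K[X] := fun c k =>
    ∑ i : Fin d, ∑ j : Fin J, C (a ^ (i : ℕ)) * (X - C l) ^ (j : ℕ) * S (r c i j) (i * e) k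
  have hr_add : ∀ c c' i j, r (c + c') i j = r c i j + r c' i j := by
    intro c c' i j
    simp only [r, Pi.add_apply, map_add, add_mul, Finset.sum_add_distrib]
  have hr_smul : ∀ (z : K) c i j, r (z • c) i j = z • r c i j := by
    intro z c i j
    simp only [r, Pi.smul_apply, smul_eq_mul, map_mul, Finset.smul_sum, smul_eq_C_mul, mul_assoc]
  let L : (Fin d × Fin J × Fin e → K) →ₗ[K] (Fin M × Fin (e + J + M * m) → K) :=
    { toFun := fun c p => (T c p.1).coeff p.2
      map_add' := by
        intro c c'
        ext p
        simp only [T, S, hr_add, map_add, mul_add, add_mul, Finset.sum_add_distrib, coeff_add,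
          Pi.add_apply]
      map_smul' := by
        intro z c
        ext p
        simp only [T, S, hr_smul, map_smul, Pi.smul_apply, RingHom.id_apply, mul_smul_comm,
          smul_mul_assoc, ← Finset.smul_sum, coeff_smul] }
  have hker : LinearMap.ker L ≠ ⊥ := by
    apply LinearMap.ker_ne_bot_of_finrank_lt
    simp only [Module.finrank_fintype_fun_eq_card, Fintype.card_prod, Fintype.card_fin]
    rw [← mul_assoc]; exact hcount
  obtain ⟨c, hcL, hc0⟩ := (Submodule.ne_bot_iff _).1 hker
  have hde0 : 0 < d * e := by
    by_contra hcon
    have : d * e = 0 := by omega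
    have : d * J * e = 0 := by rw [mul_right_comm, this, zero_mul]
    omega
  have hd0 : 0 < d := Nat.pos_of_mul_pos_right hde0
  have he0 : 0 < e := Nat.pos_of_mul_pos_left hde0
  have hr_deg : ∀ i j, (r c i j).natDegree ≤ e - 1 := by
    intro i j
    refine natDegree_sum_le_of_forall_le _ _ fun n _ => ?_
    refine (natDegree_C_mul_le _ _).trans ?_
    refine natDegree_pow_le.trans ?_
    rw [natDegree_X_sub_C]; have := n.2; omega
  have hT0 : ∀ k, k < M → T c k = 0 := by
    intro k hk
    have hdeg : (T c k).natDegree < e + J + M * m := by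
      have : (T c k).natDegree ≤ (e - 1) + J + M * m := by
        refine natDegree_sum_le_of_forall_le _ _ fun i _ => ?_
        refine natDegree_sum_le_of_forall_le _ _ fun j _ => ?_
        refine natDegree_mul_le.trans ?_
        have h1 : (C (a ^ (i : ℕ)) * (X - C l) ^ (j : ℕ)).natDegree ≤ J := by
          refine (natDegree_C_mul_le _ _).trans ?_
          refine natDegree_pow_le.trans ?_
          rw [natDegree_X_sub_C]; have := j.2; omega
        have h2 : (S (r c i j) (i * e) k).natDegree ≤ (e - 1) + M * m := by
          refine natDegree_sum_le_of_forall_le _ _ fun p hp => ?_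
          have hp' := Finset.HasAntidiagonal.mem_antidiagonal.1 hp
          refine natDegree_mul_le.trans ?_
          have h3 : (s (i * e) p.2).natDegree ≤ p.2 * m := hs' (i * e) p.2
          have h4 : (f ^ p.1 * hasseDeriv p.1 (r c i j)).natDegree ≤ p.1 * m + (e - 1) := by
            refine natDegree_mul_le.trans ?_
            have h5 := natDegree_hasseDeriv_le (r c i j) p.1
            have h6 := hr_deg i j
            have h7 : (f ^ p.1).natDegree ≤ p.1 * m := natDegree_pow_le
            omega
          have h8 : p.1 * m + p.2 * m ≤ M * m := by
            rw [← add_mul, hp']; exact Nat.mul_le_mul_right _ hk.le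
          omega
        omega
      omega
    ext n
    rw [coeff_zero]
    by_cases hn : n < e + J + M * m
    · have := congrFun (LinearMap.mem_ker.1 hcL) (⟨k, hk⟩, ⟨n, hn⟩)
      simpa [L] using this
    · exact coeff_eq_zero_of_natDegree_lt (by omega)
  let R : K[X] := ∑ i : Fin d, ∑ j : Fin J, r c i j * f ^ ((i : ℕ) * e) * (X - C l) ^ (Q * (j : ℕ))
  have hR0 : R ≠ 0 := by
    have := stepanov_nonzero l c (fun t => h ^ ((t.1 : ℕ) * e))
      (fun t => t.2.2 + t.1 * e + Q * t.2.1) ?_ ?_ hc0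
    · convert this using 1
      simp only [R, r, Fintype.sum_prod_type, Finset.sum_mul]
      refine Finset.sum_congr rfl fun i _ => Finset.sum_congr rfl fun j _ =>
        Finset.sum_congr rfl fun n _ => ?_
      rw [hf, mul_pow, pow_add, pow_add]; ring
    · rintro ⟨i, j, n⟩ ⟨i', j', n'⟩ heq
      simp only at heq
      have hb : ∀ (i : Fin d) (n : Fin e), (n : ℕ) + i * e < Q := by
        intro i n
        have : (i : ℕ) * e + e ≤ d * e := by
          rw [← Nat.succ_mul]; exact Nat.mul_le_mul_right _ i.2
        have := n.2
        omega
      have hj : (j : ℕ) = j' := by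
        have hQ0 : 0 < Q := by omega
        have h1 := congrArg (· / Q) heq
        beta_reduce at h1
        rwa [Nat.add_mul_div_left _ _ hQ0, Nat.add_mul_div_left _ _ hQ0,
          Nat.div_eq_of_lt (hb _ _), Nat.div_eq_of_lt (hb _ _), zero_add, zero_add] at h1
      have h2 : (n : ℕ) + i * e = n' + i' * e := by rw [hj] at heq; omega
      have hi : (i : ℕ) = i' := by
        have h1 := congrArg (· / e) h2
        simpa [Nat.add_mul_div_right _ _ he0, Nat.div_eq_of_lt n.2, Nat.div_eq_of_lt n'.2] using h1
      have hn : (n : ℕ) = n' := by rw [hi] at h2; omega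
      simp only [Prod.mk.injEq]
      exact ⟨Fin.ext hi, Fin.ext hj, Fin.ext hn⟩
    · intro t; simp [hl]
  have hRdeg : R.natDegree ≤ Q * (J + m) := by
    refine natDegree_sum_le_of_forall_le _ _ fun i _ => ?_
    refine natDegree_sum_le_of_forall_le _ _ fun j _ => ?_
    refine natDegree_mul_le.trans ?_
    have h1 : ((X - C l) ^ (Q * (j : ℕ))).natDegree ≤ Q * j := by
      refine natDegree_pow_le.trans ?_
      rw [natDegree_X_sub_C, mul_one]
    have h2 : (r c i j * f ^ ((i : ℕ) * e)).natDegree ≤ (e - 1) + (i * e) * m :=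
      natDegree_mul_le.trans (add_le_add (hr_deg i j) natDegree_pow_le)
    have h3 : (i * e) * m ≤ Q * m := by
      refine Nat.mul_le_mul_right _ ?_
      have : (i : ℕ) * e ≤ d * e := Nat.mul_le_mul_right _ i.2.le
      omega
    have h4 : Q * j + Q ≤ Q * J := by rw [← Nat.mul_succ]; exact Nat.mul_le_mul_left _ j.2
    have h5 : e ≤ d * e := Nat.le_mul_of_pos_left _ hd0
    rw [mul_add]; omega
  have hvan : ∀ x : K, f.eval x ≠ 0 → f.eval x ^ e = a → M ≤ R.rootMultiplicity x := by
    intro x hx hxa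
    rw [le_rootMultiplicity_iff hR0, X_sub_C_pow_dvd_iff, ← taylor_apply, X_pow_dvd_iff]
    intro k hk
    rw [taylor_coeff]
    have key : f.eval x ^ k * (hasseDeriv k R).eval x = (T c k).eval x := by
      simp only [R, T, map_sum, eval_finsetSum, Finset.mul_sum]
      refine Finset.sum_congr rfl fun i _ => Finset.sum_congr rfl fun j _ => ?_
      have e1 : (hasseDeriv k (r c i j * f ^ ((i : ℕ) * e) * (X - C l) ^ (Q * (j : ℕ)))).eval x =
          (hasseDeriv k (r c i j * f ^ ((i : ℕ) * e))).eval x * (x - l) ^ (j : ℕ) := by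
        rw [hasseDeriv_mul, eval_finsetSum, Finset.sum_eq_single (k, 0)]
        · simp [pow_mul, hQ, FiniteField.pow_card]
        · rintro ⟨p1, p2⟩ hp hne
          have hp' := Finset.HasAntidiagonal.mem_antidiagonal.1 hp
          simp only at hp'
          have : 0 < p2 := by
            rcases Nat.eq_zero_or_pos p2 with h0 | h0
            · subst h0; exact absurd (by simpa using hp') (by simpa using hne)
            · exact h0
          rw [eval_mul, hasse_eval_X_sub_C_pow l x j p2 this (by omega), mul_zero]
        · intro hp; exact absurd (by simp) hp
      have e2 : f ^ k * hasseDeriv k (r c i j * f ^ ((i : ℕ) * e)) =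
          f ^ ((i : ℕ) * e) * S (r c i j) (i * e) k := by
        rw [hasseDeriv_mul, Finset.mul_sum, Finset.mul_sum]
        refine Finset.sum_congr rfl fun p hp => ?_
        have hp' := Finset.HasAntidiagonal.mem_antidiagonal.1 hp
        rw [← hp', pow_add]
        linear_combination f ^ p.1 * hasseDeriv p.1 (r c i j) * hs (i * e) p.2
      have e3 := congrArg (eval x) e2
      simp only [eval_mul, eval_pow] at e3
      rw [e1, ← mul_assoc, e3, mul_comm (i : ℕ) e, pow_mul, hxa]
      simp only [eval_mul, eval_C, eval_pow, eval_sub, eval_X]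
      ring
    rw [hT0 k hk, eval_zero] at key
    exact (mul_eq_zero.1 key).resolve_left (pow_ne_zero _ hx)
  refine le_trans ?_ hRdeg
  refine le_trans ?_ (card_roots' R)
  calc _ = ∑ x ∈ ({x : K | f.eval x ≠ 0 ∧ f.eval x ^ e = a} : Finset K), M := by simp
    _ ≤ ∑ x ∈ ({x : K | f.eval x ≠ 0 ∧ f.eval x ^ e = a} : Finset K), R.roots.count x := by
        refine Finset.sum_le_sum fun x hx => ?_
        simp only [mem_filter, mem_univ, true_and] at hx
        rw [count_roots]; exact hvan x hx.1 hx.2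
    _ ≤ ∑ x : K, R.roots.count x := Finset.sum_le_sum_of_subset (Finset.subset_univ _)
    _ = _ := Multiset.sum_count_eq_card (fun x _ => mem_univ x)

open Polynomial in
theorem stepanov_bound (d m : ℕ) (hd : 0 < d) : ∃ B : ℝ, 0 ≤ B ∧ ∃ Q0 : ℕ,
    ∀ (K : Type) [Field K] [Fintype K] [DecidableEq K], Q0 ≤ Fintype.card K →
    ∀ (f h : K[X]) (l a : K) (e : ℕ), f = (X - C l) * h → h.eval l ≠ 0 → f.natDegree = m →
    d * e + 1 = Fintype.card K →
    (#{x : K | f.eval x ≠ 0 ∧ f.eval x ^ e = a} : ℝ) ≤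
      (Fintype.card K : ℝ) / d + B * √(Fintype.card K : ℝ) := by
  obtain ⟨c, hc⟩ : ∃ c : ℕ, c = 4 * d * (1 + d * m) := ⟨_, rfl⟩
  have hc0 : 4 * d ≤ c := by rw [hc]; exact Nat.le_mul_of_pos_right _ (by omega)
  refine ⟨2 * c * (1 + m), by positivity, 4 * c ^ 2 + 3, ?_⟩
  intro K _ _ _ hQ f h l a e hf hl hm hde
  set Q := Fintype.card K with hQdef
  have hcR : (c : ℝ) = 4 * d * (1 + d * m) := by rw [hc]; push_cast; ring
  have hc0R : (4 : ℝ) * d ≤ c := by exact_mod_cast hc0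
  have hdR : (1 : ℝ) ≤ d := by exact_mod_cast hd
  have hQR : (4 : ℝ) * c ^ 2 + 3 ≤ Q := by exact_mod_cast hQ
  have hcpos : (0 : ℝ) < c := by linarith
  set t : ℝ := √(Q : ℝ) with ht
  have htt : t * t = Q := Real.mul_self_sqrt (by positivity)
  have ht0 : 0 ≤ t := Real.sqrt_nonneg _
  have ht2 : 2 * (c : ℝ) ≤ t := by
    apply Real.le_sqrt_of_sq_le; nlinarith
  obtain ⟨j, hj⟩ : ∃ j : ℕ, j = ⌊t / c⌋₊ := ⟨_, rfl⟩
  have hj1 : (j : ℝ) ≤ t / c := by rw [hj]; exact Nat.floor_le (by positivity)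
  have hj2 : t / c < j + 1 := by rw [hj]; exact Nat.lt_floor_add_one _
  have hj3 : 2 ≤ t / c := by rw [le_div_iff₀ hcpos]; exact ht2
  have hjpos : (1 : ℝ) < j + 1 := by linarith
  have hj4 : t / c ≤ 2 * j := by
    have : (1 : ℝ) ≤ j := by
      have : 0 < j := by
        have : (0 : ℝ) < j := by linarith
        exact_mod_cast this
      exact_mod_cast this
    linarith
  have hjge : (1 : ℝ) ≤ j := by linarith
  have hjc : (j : ℝ) * c ≤ t := by rwa [le_div_iff₀ hcpos] at hj1
  have hjc2 : t ≤ 2 * j * c := by rwa [div_le_iff₀ hcpos] at hj4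
  have hdeR : (d : ℝ) * e + 1 = Q := by exact_mod_cast hde
  have hkey : (j : ℝ) * (j + 1 + d * j * m) < e := by
    have h1 : (j : ℝ) * (j + 1 + d * j * m) ≤ 2 * j * j * (1 + d * m) := by
      have : (0:ℝ) ≤ d * m := by positivity
      nlinarith [mul_nonneg this (mul_nonneg (by linarith : (0:ℝ) ≤ j) (by linarith : (0:ℝ) ≤ j))]
    have h2 : d * (2 * j * j * (1 + d * m)) = (j * j * c : ℝ) / 2 := by rw [hcR]; ring
    have h3 : (j * j * c : ℝ) ≤ (j * c) * (j * c) := by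
      have : (1 : ℝ) ≤ c := by linarith
      have h4 : (0 : ℝ) ≤ j * j * c := by positivity
      nlinarith
    have h4 : (j * c : ℝ) * (j * c) ≤ t * t := mul_self_le_mul_self (by positivity) hjc
    have h5 : (d : ℝ) * (j * (j + 1 + d * j * m)) < d * e := by
      have : (d : ℝ) * (j * (j + 1 + d * j * m)) ≤ d * (2 * j * j * (1 + d * m)) :=
        mul_le_mul_of_nonneg_left h1 (by linarith)
      nlinarith
    exact lt_of_mul_lt_mul_left h5 (by linarith)
  have hkeyN : j * (j + 1 + d * j * m) < e := by exact_mod_cast hkey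
  have hcount : (d * j) * (e + (j + 1) + (d * j) * f.natDegree) < d * (j + 1) * e := by
    rw [hm]
    have : d * (j * (j + 1 + d * j * m)) < d * e := Nat.mul_lt_mul_of_pos_left hkeyN hd
    nlinarith
  have hM : d * j ≤ Q := by
    have : (d * j : ℝ) ≤ Q := by
      have h1 : (d * j : ℝ) ≤ j * c := by nlinarith
      have h2 : t ≤ t * t := by nlinarith
      linarith
    exact_mod_cast this
  have := stepanov f h l a hf hl d e (j+1) (d*j) hde hM hcount
  rw [hm] at this
  have hR : (#{x : K | f.eval x ≠ 0 ∧ f.eval x ^ e = a} : ℝ) * (d * j) ≤ Q * (j + 1 + m) := by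
    exact_mod_cast this
  have hdj : (0 : ℝ) < d * j := by positivity
  refine ((le_div_iff₀ hdj).2 hR).trans ?_
  rw [div_le_iff₀ hdj]
  have h6 : (Q / d + 2 * c * (1 + m) * t) * (d * j : ℝ) =
    Q * j + (2 * j * c) * t * (1 + m) * d := by field_simp
  rw [h6]
  have h7 : (Q : ℝ) * (1 + m) ≤ (2 * j * c) * t * (1 + m) := by
    rw [← htt]; gcongr
  have h8 : (2 * j * c) * t * (1 + m) ≤ (2 * j * c) * t * (1 + m) * d := by
    apply le_mul_of_one_le_right (by positivity) hdR
  linarith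

open Polynomial in
theorem powersum_bound (Ω : Multiset ℂ) (R B : ℝ) (hR : 0 < R) (n0 : ℕ)
    (h : ∀ n, n0 ≤ n → ‖(Ω.map (fun w => w ^ n)).sum‖ ≤ B * R ^ n) (w : ℂ) (hw : w ∈ Ω) :
    ‖w‖ ≤ R := by
  classical
  let P : ℂ[X] := ∏ z ∈ Ω.toFinset.erase w, (X - C z)
  have hPw : P.eval w ≠ 0 := by
    simp only [P, eval_prod, Finset.prod_ne_zero_iff]
    intro z hz
    simp only [eval_sub, eval_X, eval_C]
    exact sub_ne_zero.2 (Finset.ne_of_mem_erase hz).symm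
  have hPz : ∀ z ∈ Ω, z ≠ w → P.eval z = 0 := by
    intro z hz hzw
    simp only [P, eval_prod]
    exact Finset.prod_eq_zero (Finset.mem_erase.2 ⟨hzw, Multiset.mem_toFinset.2 hz⟩) (by simp)
  have key : ∀ n, ∑ j ∈ range (P.natDegree + 1), P.coeff j * (Ω.map (fun w => w ^ (n + j))).sum =
      (Ω.count w : ℂ) * (P.eval w * w ^ n) := by
    intro n
    have h1 : ∑ j ∈ range (P.natDegree + 1), P.coeff j * (Ω.map (fun w => w ^ (n + j))).sum =
        (Ω.map (fun z => P.eval z * z ^ n)).sum := by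
      simp_rw [← Multiset.sum_map_mul_left]
      rw [← Multiset.sum_map_sum]
      refine congrArg _ (Multiset.map_congr rfl fun z _ => ?_)
      rw [eval_eq_sum_range, Finset.sum_mul]
      refine Finset.sum_congr rfl fun j _ => ?_
      rw [pow_add]; ring
    rw [h1, Finset.sum_multiset_map_count, Finset.sum_eq_single w]
    · simp
    · intro z hz hzw
      rw [hPz z (Multiset.mem_toFinset.1 hz) hzw]; simp
    · intro hh; exact absurd (Multiset.mem_toFinset.2 hw) hh
  have hcount : (1 : ℝ) ≤ (Ω.count w : ℝ) := by
    exact_mod_cast Multiset.one_le_count_iff_mem.2 hw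
  obtain ⟨D, hD⟩ : ∃ D : ℝ, D = ∑ j ∈ range (P.natDegree + 1), ‖P.coeff j‖ * (B * R ^ j) := ⟨_, rfl⟩
  have hbd : ∀ n, n0 ≤ n → ‖P.eval w‖ * ‖w‖ ^ n ≤ D * R ^ n := by
    intro n hn
    calc ‖P.eval w‖ * ‖w‖ ^ n ≤ (Ω.count w : ℝ) * (‖P.eval w‖ * ‖w‖ ^ n) :=
          le_mul_of_one_le_left (by positivity) hcount
      _ = ‖(Ω.count w : ℂ) * (P.eval w * w ^ n)‖ := by simp
      _ ≤ ∑ j ∈ range (P.natDegree + 1), ‖P.coeff j * (Ω.map (fun w => w ^ (n + j))).sum‖ := by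
          rw [← key]; exact norm_sum_le _ _
      _ ≤ ∑ j ∈ range (P.natDegree + 1), (‖P.coeff j‖ * (B * R ^ j)) * R ^ n := by
          refine Finset.sum_le_sum fun j _ => ?_
          rw [norm_mul, mul_assoc]
          refine mul_le_mul_of_nonneg_left ?_ (norm_nonneg _)
          refine (h (n + j) (by omega)).trans (le_of_eq ?_)
          rw [pow_add]; ring
      _ = D * R ^ n := by rw [hD, Finset.sum_mul]
  by_contra hcon
  push Not at hcon
  have hr : 1 < ‖w‖ / R := by rwa [one_lt_div hR]
  have hlim := tendsto_pow_atTop_atTop_of_one_lt hr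
  have hPpos : 0 < ‖P.eval w‖ := norm_pos_iff.2 hPw
  obtain ⟨n, hn1, hn2⟩ := ((hlim.eventually_gt_atTop (D / ‖P.eval w‖)).and
    (Filter.eventually_ge_atTop n0)).exists
  have := hbd n hn2
  rw [div_pow, div_lt_div_iff₀ hPpos (by positivity)] at hn1
  linarith [mul_comm ‖P.eval w‖ (‖w‖ ^ n)]

open Polynomial in
theorem poly_factor (n : ℕ) (L : ℂ[X]) (hL : L.coeff 0 = 1) (hn : L.natDegree ≤ n) :
    ∃ Ω : Multiset ℂ, Ω.card ≤ n ∧ L = (Ω.map (fun w => 1 - C w * X)).prod := by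
  have hL0 : L ≠ 0 := by rintro rfl; simp at hL
  have hsp := (IsAlgClosed.splits L).eq_prod_roots
  have hz : ∀ z ∈ L.roots, z ≠ 0 := by
    rintro z hz rfl
    have := (mem_roots hL0).1 hz
    rw [IsRoot, ← coeff_zero_eq_eval_zero, hL] at this
    exact one_ne_zero this
  refine ⟨L.roots.map (fun z => z⁻¹), ?_, ?_⟩
  · rw [Multiset.card_map]; exact (card_roots' L).trans hn
  · have h1 : (L.roots.map (fun z => X - C z)).prod =
        (L.roots.map (fun z => C (-z))).prod *
        ((L.roots.map (fun z => z⁻¹)).map (fun w => 1 - C w * X)).prod := by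
      rw [Multiset.map_map, ← Multiset.prod_map_mul]
      congr 1
      refine Multiset.map_congr rfl fun z hz' => ?_
      have := hz z hz'
      simp only [Function.comp]
      rw [mul_sub, mul_one, ← mul_assoc, ← C_mul, neg_mul, mul_inv_cancel₀ this]
      simp; ring
    rw [h1, ← mul_assoc] at hsp
    have h2 : ∃ c : ℂ, C L.leadingCoeff * (L.roots.map (fun z => C (-z))).prod = C c := by
      refine ⟨L.leadingCoeff * (L.roots.map (fun z => (-z))).prod, ?_⟩
      rw [C_mul, map_multiset_prod, Multiset.map_map]; rfl
    obtain ⟨c, hc⟩ := h2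
    rw [hc] at hsp
    have h3 : c = 1 := by
      have := congrArg (eval 0) hsp
      rw [← coeff_zero_eq_eval_zero, hL, eval_mul, eval_C, eval_multiset_prod, Multiset.map_map] at this
      simpa using this.symm
    rw [h3, C_1, one_mul] at hsp
    exact hsp

theorem newton_multiset (Ω : Multiset ℂ) :
    PowerSeries.derivative ℂ (Ω.map (fun w => (1 - PowerSeries.C w * PowerSeries.X : PowerSeries ℂ))).prod =
    (Ω.map (fun w => (1 - PowerSeries.C w * PowerSeries.X : PowerSeries ℂ))).prod *
      (- PowerSeries.mk (fun n => (Ω.map (fun w => w ^ (n + 1))).sum)) := by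
  induction Ω using Multiset.induction_on with
  | empty => 
    simp
    ext; simp
  | cons a s ih =>
    have h1 : (1 - PowerSeries.C a * PowerSeries.X : PowerSeries ℂ) *
      PowerSeries.mk (fun n => a ^ (n + 1)) = PowerSeries.C a := by
      ext n
      rw [sub_mul, one_mul, mul_assoc, map_sub, PowerSeries.coeff_C_mul]
      rcases n with _ | n
      · simp
      · rw [PowerSeries.coeff_succ_X_mul]; simp; ring
    have h2 : PowerSeries.mk (fun n => ((a ::ₘ s).map (fun w => w ^ (n + 1))).sum) =
       PowerSeries.mk (fun n => a ^ (n + 1)) + PowerSeries.mk (fun n => (s.map (fun w => w ^ (n + 1))).sum) := by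
      ext n; simp
    rw [h2, Multiset.map_cons, Multiset.prod_cons, Derivation.leibniz, ih]
    simp only [map_sub, smul_eq_mul, Derivation.leibniz, PowerSeries.derivative_C, PowerSeries.derivative_X, Derivation.map_one_eq_zero]
    linear_combination ((s.map (fun w => (1 - PowerSeries.C w * PowerSeries.X : PowerSeries ℂ))).prod) * h1

open Polynomial in
theorem lfun_bound (A S : ℕ → ℂ) (m n0 : ℕ) (R B : ℝ) (hR : 0 < R) (hA0 : A 0 = 1)
    (hAm : ∀ n, m < n → A n = 0)
    (hN : ∀ n : ℕ, ((n : ℂ) + 1) * A (n + 1) =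
      ∑ p ∈ HasAntidiagonal.antidiagonal n, A p.1 * S (p.2 + 1))
    (hS : ∀ n, n0 ≤ n → ‖S n‖ ≤ B * R ^ n) : ‖S 1‖ ≤ m * R := by
  let L : ℂ[X] := ∑ n ∈ range (m + 1), monomial n (A n)
  have hLc : ∀ n, L.coeff n = A n := by
    intro n
    simp only [L, finsetSum_coeff, coeff_monomial]
    rw [Finset.sum_ite_eq' ]
    split_ifs with h
    · rfl
    · rw [hAm n (by simpa using h)]
  obtain ⟨Ω, hΩ, hL⟩ := poly_factor m L (by rw [hLc, hA0])
    (natDegree_le_iff_coeff_eq_zero.2 fun n hn => by rw [hLc, hAm n hn])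
  have hLp : (L : PowerSeries ℂ) =
    (Ω.map (fun w => (1 - PowerSeries.C w * PowerSeries.X : PowerSeries ℂ))).prod := by
    rw [hL]
    rw [← Polynomial.coeToPowerSeries.ringHom_apply, map_multiset_prod, Multiset.map_map]
    congr 1
    refine Multiset.map_congr rfl fun w _ => ?_
    simp
  have h1 : PowerSeries.derivative ℂ (L : PowerSeries ℂ) = (L : PowerSeries ℂ) * PowerSeries.mk (fun n => S (n + 1)) := by
    ext n
    rw [PowerSeries.coeff_derivative, PowerSeries.coeff_mul]
    simp only [Polynomial.coeff_coe, hLc, PowerSeries.coeff_mk]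
    rw [← hN, mul_comm]
  have h2 := newton_multiset Ω
  rw [← hLp, h1] at h2
  have hL0 : (L : PowerSeries ℂ) ≠ 0 := by
    intro h
    have := congrArg (PowerSeries.coeff 0) h
    rw [Polynomial.coeff_coe, hLc, hA0] at this
    simp at this
  have h3 := mul_left_cancel₀ hL0 h2
  have h4 : ∀ n, S (n + 1) = - (Ω.map (fun w => w ^ (n + 1))).sum := by
    intro n
    have := congrArg (PowerSeries.coeff n) h3
    simpa using this
  have h5 : ∀ w ∈ Ω, ‖w‖ ≤ R := by
    refine powersum_bound Ω R B hR (n0 + 1) ?_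
    intro n hn
    obtain ⟨k, rfl⟩ : ∃ k, n = k + 1 := ⟨n - 1, by omega⟩
    have := hS (k + 1) (by omega)
    rwa [h4, norm_neg] at this
  have h6 := h4 0
  rw [zero_add] at h6
  rw [h6, norm_neg]
  calc ‖(Ω.map (fun w => w ^ 1)).sum‖ ≤ ((Ω.map (fun w => w ^ 1)).map (fun w => ‖w‖)).sum :=
        norm_multiset_sum_le _
    _ ≤ (Ω.card : ℝ) * R := by
        rw [Multiset.map_map, ← nsmul_eq_mul]
        refine (Multiset.sum_le_card_nsmul _ R ?_).trans (by simp)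
        intro x hx
        obtain ⟨w, hw, rfl⟩ := Multiset.mem_map.1 hx
        simpa using h5 w hw
    _ ≤ m * R := by gcongr

open Polynomial in
theorem monics_finite (F : Type*) [Field F] [Fintype F] (n : ℕ) :
    {g : F[X] | g.Monic ∧ g.natDegree = n}.Finite := by
  refine Set.Finite.of_injOn (f := fun g : F[X] => fun i : Fin (n + 1) => g.coeff i)
    (t := Set.univ) (fun _ _ => Set.mem_univ _) ?_ Set.finite_univ
  rintro g ⟨_, hg⟩ g' ⟨_, hg'⟩ h
  ext i
  by_cases hi : i < n + 1
  · exact congrFun h ⟨i, hi⟩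
  · rw [coeff_eq_zero_of_natDegree_lt (by omega), coeff_eq_zero_of_natDegree_lt (by omega)]

open Polynomial in
/-- The finite set of monic polynomials of degree `n`. -/
noncomputable def monics (F : Type*) [Field F] [Fintype F] (n : ℕ) : Finset F[X] :=
  (monics_finite F n).toFinset

open Polynomial in
theorem mem_monics {F : Type*} [Field F] [Fintype F] {n : ℕ} {g : F[X]} :
    g ∈ monics F n ↔ g.Monic ∧ g.natDegree = n := by simp [monics]

open Polynomial in
open Classical in
/-- The finite set of monic irreducible polynomials of degree `n`. -/
noncomputable def irrs (F : Type*) [Field F] [Fintype F] (n : ℕ) : Finset F[X] :=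
  (monics F n).filter (fun g => Irreducible g)

open Polynomial in
theorem mem_irrs {F : Type*} [Field F] [Fintype F] {n : ℕ} {g : F[X]} :
    g ∈ irrs F n ↔ (g.Monic ∧ g.natDegree = n) ∧ Irreducible g := by simp [irrs, mem_monics]

open Polynomial in
open Classical in
theorem degree_formula {F : Type*} [Field F] [Fintype F] (N : ℕ) (g : F[X]) (hg : g.Monic)
    (hN : g.natDegree = N) :
    ∑ e ∈ Icc 1 N, ∑ P ∈ irrs F e, ∑ j ∈ Icc 1 N, (if P ^ j ∣ g then e else 0) = N := by
  have hg0 := hg.ne_zero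
  let nf := UniqueFactorizationMonoid.normalizedFactors g
  have hnf : ∀ P ∈ nf, P.Monic ∧ Irreducible P := by
    intro P hP
    have h1 := UniqueFactorizationMonoid.irreducible_of_normalized_factor P hP
    refine ⟨?_, h1⟩
    have := UniqueFactorizationMonoid.normalize_normalized_factor P hP
    rw [← this]; exact monic_normalize h1.ne_zero
  have hprod : nf.prod = g := by
    have h1 := UniqueFactorizationMonoid.prod_normalizedFactors hg0
    have h2 := monic_multiset_prod_of_monic nf id (fun P hP => (hnf P hP).1)
    rw [Multiset.map_id] at h2
    exact eq_of_monic_of_associated h2 hg h1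
  have hinner : ∀ e ∈ Icc 1 N, ∀ P ∈ irrs F e, ∑ j ∈ Icc 1 N, (if P ^ j ∣ g then e else 0) =
      nf.count P * P.natDegree := by
    intro e he P hP
    obtain ⟨⟨hP1, hP2⟩, hP3⟩ := mem_irrs.1 hP
    have hem := UniqueFactorizationMonoid.emultiplicity_eq_count_normalizedFactors hP3 hg0
    rw [hP1.normalize_eq_self] at hem
    have hiff : ∀ j, P ^ j ∣ g ↔ j ≤ nf.count P := by
      intro j
      rw [pow_dvd_iff_le_emultiplicity, hem]; exact Nat.cast_le
    have hcN : nf.count P ≤ N := by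
      have h1 := natDegree_le_of_dvd ((hiff _).2 le_rfl) hg0
      rw [natDegree_pow, hP2, hN] at h1
      have h2 := (Finset.mem_Icc.1 he).1
      nlinarith
    rw [← Finset.sum_filter, Finset.sum_const, smul_eq_mul, hP2]
    congr 1
    have : (Icc 1 N).filter (fun j => P ^ j ∣ g) = Icc 1 (nf.count P) := by
      ext j
      simp only [mem_filter, mem_Icc, hiff]
      omega
    rw [this, Nat.card_Icc]; omega
  rw [Finset.sum_congr rfl fun e he => Finset.sum_congr rfl fun P hP => hinner e he P hP]
  rw [← Finset.sum_biUnion]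
  · have hdeg : N = (nf.map natDegree).sum := by
      rw [← hN]
      conv_lhs => rw [← hprod]
      exact natDegree_multiset_prod_of_monic _ (fun P hP => (hnf P hP).1)
    conv_rhs => rw [hdeg, Finset.sum_multiset_map_count]
    symm
    apply Finset.sum_subset
    · intro P hP
      have hP' := Multiset.mem_toFinset.1 hP
      obtain ⟨h1, h2⟩ := hnf P hP'
      simp only [mem_biUnion, mem_Icc]
      refine ⟨P.natDegree, ⟨h2.natDegree_pos, ?_⟩, mem_irrs.2 ⟨⟨h1, rfl⟩, h2⟩⟩
      rw [← hN]
      exact natDegree_le_of_dvd (UniqueFactorizationMonoid.dvd_of_mem_normalizedFactors hP') hg0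
    · intro P _ hP
      rw [Multiset.mem_toFinset] at hP
      simp [Multiset.count_eq_zero_of_notMem hP]
  · intro e _ e' _ hee
    rw [Function.onFun, Finset.disjoint_left]
    intro P hP hP'
    exact hee ((mem_irrs.1 hP).1.2.symm.trans (mem_irrs.1 hP').1.2)

open Polynomial in
open Classical in
theorem sum_dvd_monics {F : Type*} [Field F] [Fintype F] (φ : F[X] →* ℂ) (N e j : ℕ) (P : F[X])
    (hP : P.Monic) (he : P.natDegree = e) :
    ∑ g ∈ monics F N, (if P ^ j ∣ g then φ g else 0) =
      if e * j ≤ N then φ P ^ j * ∑ g ∈ monics F (N - e * j), φ g else 0 := by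
  have hPj := hP.pow j
  have hdeg : (P ^ j).natDegree = e * j := by rw [hP.natDegree_pow, he, mul_comm]
  rw [← Finset.sum_filter]
  split_ifs with h
  · rw [Finset.mul_sum]
    symm
    refine Finset.sum_bij (fun g _ => P ^ j * g) ?_ ?_ ?_ ?_
    · intro g hg
      obtain ⟨h1, h2⟩ := mem_monics.1 hg
      rw [mem_filter, mem_monics]
      refine ⟨⟨hPj.mul h1, ?_⟩, dvd_mul_right _ _⟩
      rw [hPj.natDegree_mul h1, hdeg, h2]; omega
    · intro g _ g' _ hgg
      exact mul_left_cancel₀ hPj.ne_zero hgg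
    · intro g hg
      rw [mem_filter, mem_monics] at hg
      obtain ⟨⟨h1, h2⟩, u, rfl⟩ := hg
      have hu : u.Monic := hPj.of_mul_monic_left h1
      refine ⟨u, mem_monics.2 ⟨hu, ?_⟩, rfl⟩
      rw [hPj.natDegree_mul hu, hdeg] at h2; omega
    · intro g _; rw [map_mul, map_pow]
  · rw [Finset.filter_eq_empty_iff.2, Finset.sum_empty]
    intro g hg hd
    obtain ⟨h1, h2⟩ := mem_monics.1 hg
    have := natDegree_le_of_dvd hd h1.ne_zero
    omega

open Polynomial in
/-- Power sums attached to a multiplicative function on polynomials. -/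
noncomputable def psumφ {F : Type*} [Field F] [Fintype F] (φ : F[X] →* ℂ) (k : ℕ) : ℂ :=
  ∑ p ∈ k.divisorsAntidiagonal, ∑ P ∈ irrs F p.1, (p.1 : ℂ) * φ P ^ p.2

open Polynomial in
open Classical in
theorem newton_poly {F : Type*} [Field F] [Fintype F] (φ : F[X] →* ℂ) (n : ℕ) :
    ((n : ℂ) + 1) * ∑ g ∈ monics F (n + 1), φ g =
      ∑ p ∈ HasAntidiagonal.antidiagonal n, (∑ g ∈ monics F p.1, φ g) * psumφ φ (p.2 + 1) := by
  set N := n + 1 with hN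
  have h1 : ((n : ℂ) + 1) * ∑ g ∈ monics F N, φ g =
      ∑ g ∈ monics F N, ∑ e ∈ Icc 1 N, ∑ P ∈ irrs F e, ∑ j ∈ Icc 1 N,
        (e : ℂ) * (if P ^ j ∣ g then φ g else 0) := by
    rw [Finset.mul_sum]
    refine Finset.sum_congr rfl fun g hg => ?_
    obtain ⟨hg1, hg2⟩ := mem_monics.1 hg
    have := congrArg (Nat.cast : ℕ → ℂ) (degree_formula N g hg1 hg2)
    push_cast at this
    rw [show ((n : ℂ) + 1) = (N : ℂ) by rw [hN]; push_cast; rfl, ← this, Finset.sum_mul]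
    refine Finset.sum_congr rfl fun e _ => ?_
    rw [Finset.sum_mul]
    refine Finset.sum_congr rfl fun P _ => ?_
    rw [Finset.sum_mul]
    refine Finset.sum_congr rfl fun j _ => ?_
    split_ifs <;> simp
  have h2 : ((n : ℂ) + 1) * ∑ g ∈ monics F N, φ g =
      ∑ e ∈ Icc 1 N, ∑ j ∈ Icc 1 N, ∑ P ∈ irrs F e,
        (e : ℂ) * (if e * j ≤ N then φ P ^ j * ∑ g ∈ monics F (N - e * j), φ g else 0) := by
    rw [h1, Finset.sum_comm]
    refine Finset.sum_congr rfl fun e _ => ?_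
    rw [Finset.sum_comm, Finset.sum_comm (s := Icc 1 N)]
    refine Finset.sum_congr rfl fun P hP => ?_
    rw [Finset.sum_comm]
    refine Finset.sum_congr rfl fun j _ => ?_
    obtain ⟨⟨hP1, hP2⟩, hP3⟩ := mem_irrs.1 hP
    rw [← Finset.mul_sum, sum_dvd_monics φ N e j P hP1 hP2]
  rw [h2]
  have h3 : ∀ k ∈ Icc 1 N, (∑ g ∈ monics F (N - k), φ g) * psumφ φ k =
      ∑ e ∈ Icc 1 N, ∑ j ∈ Icc 1 N, (if e * j = k then ∑ P ∈ irrs F e,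
        (e : ℂ) * (φ P ^ j * ∑ g ∈ monics F (N - e * j), φ g) else 0) := by
    intro k hk
    rw [← Finset.sum_product', ← Finset.sum_filter, psumφ, Finset.mul_sum]
    have hk' := Finset.mem_Icc.1 hk
    have hset : k.divisorsAntidiagonal =
        (Icc 1 N ×ˢ Icc 1 N).filter (fun p => p.1 * p.2 = k) := by
      ext ⟨a, b⟩
      simp only [Nat.mem_divisorsAntidiagonal, mem_filter, mem_product, mem_Icc]
      constructor
      · rintro ⟨rfl, h0⟩
        have ha : 0 < a := Nat.pos_of_ne_zero (by rintro rfl; simp at h0)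
        have hb : 0 < b := Nat.pos_of_ne_zero (by rintro rfl; simp at h0)
        have := Nat.le_mul_of_pos_right a hb
        have := Nat.le_mul_of_pos_left b ha
        refine ⟨⟨⟨ha, by omega⟩, ⟨hb, by omega⟩⟩, rfl⟩
      · rintro ⟨_, h⟩
        exact ⟨h, by omega⟩
    rw [hset]
    refine Finset.sum_congr rfl fun p hp => ?_
    have hp' := (Finset.mem_filter.1 hp).2
    rw [Finset.mul_sum]
    refine Finset.sum_congr rfl fun P _ => ?_
    rw [hp']; ring
  have h4 : ∑ p ∈ HasAntidiagonal.antidiagonal n, (∑ g ∈ monics F p.1, φ g) * psumφ φ (p.2 + 1) =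
      ∑ k ∈ Icc 1 N, (∑ g ∈ monics F (N - k), φ g) * psumφ φ k := by
    refine Finset.sum_bij (fun p _ => p.2 + 1) ?_ ?_ ?_ ?_
    · intro p hp
      have := Finset.HasAntidiagonal.mem_antidiagonal.1 hp
      rw [mem_Icc]; omega
    · intro p hp p' hp' h
      have := Finset.HasAntidiagonal.mem_antidiagonal.1 hp
      have := Finset.HasAntidiagonal.mem_antidiagonal.1 hp'
      ext <;> omega
    · intro k hk
      rw [mem_Icc] at hk
      exact ⟨(N - k, k - 1), Finset.HasAntidiagonal.mem_antidiagonal.2 (by simp only; omega), by simp only; omega⟩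
    · intro p hp
      have := Finset.HasAntidiagonal.mem_antidiagonal.1 hp
      rw [show N - (p.2 + 1) = p.1 by omega]
  rw [h4, Finset.sum_congr rfl h3]
  conv_rhs => rw [Finset.sum_comm]
  refine Finset.sum_congr rfl fun e he => ?_
  conv_rhs => rw [Finset.sum_comm]
  refine Finset.sum_congr rfl fun j hj => ?_
  rw [Finset.sum_ite_eq]
  have h5 : e * j ∈ Icc 1 N ↔ e * j ≤ N := by
    rw [mem_Icc] at he hj ⊢
    have := Nat.mul_pos he.1 hj.1
    omega
  simp only [h5]
  split_ifs
  · rfl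
  · simp

open Polynomial in
theorem norm_sub_minpoly {F K : Type*} [Field F] [Field K] [Algebra F K] [FiniteDimensional F K]
    (x : K) (b : F) : Algebra.norm F (algebraMap F K b - x) =
      ((minpoly F x).eval b) ^ (Module.finrank F K / (minpoly F x).natDegree) := by
  have gen : ∀ z : K, Algebra.norm F z = ((-1) ^ (minpoly F z).natDegree * (minpoly F z).coeff 0) ^
      (Module.finrank F K / (minpoly F z).natDegree) := by
    intro z
    have hz : IsIntegral F z := IsIntegral.of_finite F z
    rw [Algebra.norm_eq_norm_adjoin]
    have h1 := Algebra.PowerBasis.norm_gen_eq_coeff_zero_minpoly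
      (IntermediateField.adjoin.powerBasis hz)
    rw [IntermediateField.adjoin.powerBasis_gen, IntermediateField.adjoin.powerBasis_dim,
      IntermediateField.minpoly_gen] at h1
    rw [h1]
    congr 1
    rw [← IntermediateField.adjoin.finrank hz,
      ← Module.finrank_mul_finrank F (IntermediateField.adjoin F {z}) K]
    exact (Nat.mul_div_cancel_left _ Module.finrank_pos).symm
  have hx : (minpoly F (algebraMap F K b - x)) =
      (-1) ^ (natDegree (minpoly F x)) * ((minpoly F x).comp (X + C b)).comp (-X) := by
    rw [← neg_sub, minpoly.neg, minpoly.sub_algebraMap, natDegree_comp, natDegree_X_add_C, mul_one]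
  have hdeg : (minpoly F (algebraMap F K b - x)).natDegree = (minpoly F x).natDegree := by
    have hc : ((-1 : F[X]) ^ (natDegree (minpoly F x))) = C ((-1) ^ (natDegree (minpoly F x))) := by
      simp
    rw [hx, hc, natDegree_C_mul (by simp), natDegree_comp, natDegree_comp, natDegree_X_add_C,
      natDegree_neg, natDegree_X, mul_one, mul_one]
  rw [gen, hdeg]
  congr 1
  rw [hx, coeff_zero_eq_eval_zero]
  simp only [eval_mul, eval_pow, eval_neg, eval_one, eval_comp, eval_X, eval_add, eval_C, neg_zero,
    zero_add]
  rw [← mul_assoc, ← mul_pow]; simp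

open Polynomial in
open Classical in
theorem card_minpoly_eq {F K : Type*} [Field F] [Fintype F] [Field K] [Fintype K] [Algebra F K]
    (P : F[X]) (hP : P.Monic) (hi : Irreducible P) (hd : P.natDegree ∣ Module.finrank F K) :
    #{x : K | minpoly F x = P} = P.natDegree := by
  have hsep : P.Separable := PerfectField.separable_of_irreducible hi
  have hcard : Nat.card K = Nat.card F ^ Module.finrank F K := Module.natCard_eq_pow_finrank
  have hsplit : (P.map (algebraMap F K)).Splits := by
    have h1 := hi.natDegree_dvd_iff_dvd_X_pow_card_pow_sub_X.1 hd
    have h2 := map_dvd (mapRingHom (algebraMap F K)) h1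
    simp only [coe_mapRingHom, Polynomial.map_sub, Polynomial.map_pow, map_X] at h2
    rw [← hcard] at h2
    refine Splits.of_dvd (Polynomial.splits_X_pow_nat_card_sub_X) ?_ h2
    exact FiniteField.X_pow_card_sub_X_ne_zero K Finite.one_lt_card
  rw [← card_rootSet_eq_natDegree hsep hsplit]
  rw [Fintype.card_subtype]
  congr 1
  ext x
  simp only [mem_filter, mem_univ, true_and]
  rw [mem_rootSet]
  constructor
  · rintro rfl
    exact ⟨hP.ne_zero, minpoly.aeval F x⟩
  · rintro ⟨_, h⟩
    exact (minpoly.eq_of_irreducible_of_monic hi h hP).symm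

open Polynomial in
open Classical in
theorem psumφ_eq {F K : Type*} [Field F] [Fintype F] [Field K] [Fintype K] [Algebra F K]
    (φ : F[X] →* ℂ) : psumφ φ (Module.finrank F K) =
      ∑ x : K, φ (minpoly F x) ^ (Module.finrank F K / (minpoly F x).natDegree) := by
  set k := Module.finrank F K with hk
  have hk0 : 0 < k := Module.finrank_pos
  rw [psumφ, Nat.sum_divisorsAntidiagonal (f := fun e j => ∑ P ∈ irrs F e, (e : ℂ) * φ P ^ j)]
  have h1 : ∀ e ∈ k.divisors, ∑ P ∈ irrs F e, (e : ℂ) * φ P ^ (k / e) =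
      ∑ P ∈ irrs F e, ∑ x : K with minpoly F x = P,
        φ (minpoly F x) ^ (k / (minpoly F x).natDegree) := by
    intro e he
    refine Finset.sum_congr rfl fun P hP => ?_
    obtain ⟨⟨hP1, hP2⟩, hP3⟩ := mem_irrs.1 hP
    have hed := Nat.dvd_of_mem_divisors he
    rw [Finset.sum_congr rfl (g := fun _ => φ P ^ (k / e))]
    · rw [Finset.sum_const, card_minpoly_eq P hP1 hP3 (by rw [hP2]; exact hed), hP2, nsmul_eq_mul]
    · intro x hx
      rw [(mem_filter.1 hx).2, hP2]
  rw [Finset.sum_congr rfl h1, ← Finset.sum_biUnion]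
  · apply Finset.sum_fiberwise_of_maps_to
    intro x _
    have hx : IsIntegral F x := IsIntegral.of_finite F x
    simp only [mem_biUnion]
    refine ⟨(minpoly F x).natDegree, ?_, mem_irrs.2 ⟨⟨minpoly.monic hx, rfl⟩, minpoly.irreducible hx⟩⟩
    rw [Nat.mem_divisors]
    exact ⟨minpoly.degree_dvd hx, hk0.ne'⟩
  · intro e _ e' _ hee
    rw [Function.onFun, Finset.disjoint_left]
    intro P hP hP'
    exact hee ((mem_irrs.1 hP).1.2.symm.trans (mem_irrs.1 hP').1.2)

open Polynomial in
/-- The multiplicative function on polynomials attached to a character and a divisor. -/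
noncomputable def charφ {F : Type*} [Field F] (χ : MulChar F ℂ) (Λ : Finset F) (a : F → ℕ) :
    F[X] →* ℂ where
  toFun g := χ (∏ z ∈ Λ, g.eval z ^ a z)
  map_one' := by simp
  map_mul' g g' := by simp [mul_pow, Finset.prod_mul_distrib]

open Polynomial in
open Classical in
theorem psum_charφ {F K : Type*} [Field F] [Fintype F] [Field K] [Fintype K] [Algebra F K]
    (χ : MulChar F ℂ) (Λ : Finset F) (a : F → ℕ) :
    psumφ (charφ χ Λ a) (Module.finrank F K) =
      ∑ x : K, χ (Algebra.norm F ((∏ z ∈ Λ, (C (algebraMap F K z) - X) ^ a z).eval x)) := by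
  rw [psumφ_eq (K := K)]
  refine Finset.sum_congr rfl fun x _ => ?_
  rw [eval_prod, map_prod]
  simp only [eval_pow, eval_sub, eval_C, eval_X, map_pow, norm_sub_minpoly]
  change χ _ ^ _ = _
  rw [← map_pow, ← Finset.prod_pow]
  congr 1
  refine Finset.prod_congr rfl fun z _ => ?_
  rw [← pow_mul, ← pow_mul, mul_comm]

theorem mulchar_norm_eq {F : Type*} [Field F] [Fintype F] (χ : MulChar F ℂ) {x : F} (hx : x ≠ 0) :
    ‖χ x‖ = 1 := by
  have h1 : (χ x) ^ (Fintype.card F - 1) = 1 := by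
    rw [← map_pow, FiniteField.pow_card_sub_one_eq_one x hx, map_one]
  have := Fintype.one_lt_card (α := F)
  exact Complex.norm_eq_one_of_pow_eq_one h1 (by omega)

theorem mulchar_norm_le {F : Type*} [Field F] [Fintype F] (χ : MulChar F ℂ) (x : F) :
    ‖χ x‖ ≤ 1 := by
  by_cases hx : x = 0
  · rw [hx, MulChar.map_zero]; simp
  · exact (mulchar_norm_eq χ hx).le

open Classical in
theorem char_dist {F : Type*} [Field F] [Fintype F] (χ : MulChar F ℂ) (hχ : χ ≠ 1)
    (n : F → ℕ) (U : ℝ) (hU : ∀ b, b ≠ 0 → (n b : ℝ) ≤ U) :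
    ‖∑ b, χ b * (n b : ℂ)‖ ≤ ((Fintype.card F : ℝ) - 1) * U - ∑ b, (n b : ℝ) + n 0 := by
  have h0 : ∑ b, χ b * (n b : ℂ) = ∑ b, χ b * ((n b : ℂ) - (U : ℂ)) := by
    simp only [mul_sub, Finset.sum_sub_distrib, ← Finset.sum_mul]
    rw [MulChar.sum_eq_zero_of_ne_one hχ, zero_mul, sub_zero]
  rw [h0, ← Finset.add_sum_erase _ _ (mem_univ (0 : F)), MulChar.map_zero, zero_mul, zero_add]
  refine (norm_sum_le _ _).trans ?_
  have h1 : ∑ b ∈ univ.erase (0 : F), ‖χ b * ((n b : ℂ) - (U : ℂ))‖ ≤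
      ∑ b ∈ univ.erase (0 : F), (U - n b) := by
    refine Finset.sum_le_sum fun b hb => ?_
    have hb0 : b ≠ 0 := (mem_erase.1 hb).1
    rw [norm_mul, mulchar_norm_eq χ hb0, one_mul]
    have : ((n b : ℂ) - (U : ℂ)) = (((n b : ℝ) - U : ℝ) : ℂ) := by push_cast; rfl
    rw [this, Complex.norm_real, Real.norm_eq_abs, abs_of_nonpos (by linarith [hU b hb0])]
    linarith
  refine h1.trans ?_
  rw [Finset.sum_sub_distrib, Finset.sum_const, card_erase_of_mem (mem_univ _), card_univ,
    ← Finset.add_sum_erase _ (fun b => (n b : ℝ)) (mem_univ (0 : F)), nsmul_eq_mul,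
    Nat.cast_sub Fintype.card_pos]
  push_cast
  linarith

open Polynomial in
open Classical in
theorem ext_bound (F : Type) [Field F] [Fintype F] (χ : MulChar F ℂ) (hχ : χ ≠ 1)
    (Λ : Finset F) (a : F → ℕ) (l : F) (hl : l ∈ Λ) (hal : a l = 1) :
    ∃ B : ℝ, ∃ n0 : ℕ, ∀ k, n0 ≤ k →
      ‖psumφ (charφ χ Λ a) k‖ ≤ B * (√(Fintype.card F : ℝ)) ^ k := by
  set q := Fintype.card F with hq
  have hq1 : 1 < q := Fintype.one_lt_card
  obtain ⟨p, hp⟩ := CharP.exists F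
  haveI : Fact p.Prime := ⟨CharP.char_is_prime F p⟩
  set m := ∑ z ∈ Λ, a z with hm
  obtain ⟨B, hB, Q0, hst⟩ := stepanov_bound (q - 1) m (by omega)
  refine ⟨(q - 1 : ℕ) * B + m, Q0 + 1, fun k hk => ?_⟩
  haveI : NeZero k := ⟨by omega⟩
  let K := FiniteField.Extension F p k
  letI : Fintype K := Fintype.ofFinite K
  have hfin : Module.finrank F K = k := FiniteField.finrank_extension F p k
  have hcard : Fintype.card K = q ^ k := by
    rw [← Nat.card_eq_fintype_card, FiniteField.natCard_extension, Nat.card_eq_fintype_card]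
  set Q := Fintype.card K with hQ
  have hQ0 : Q0 ≤ Q := by
    rw [hcard]
    have : k < q ^ k := Nat.lt_pow_self hq1
    omega
  have hkey := psum_charφ (K := K) χ Λ a
  rw [hfin] at hkey
  rw [hkey]
  set f : K[X] := ∏ z ∈ Λ, (C (algebraMap F K z) - X) ^ a z with hf
  set h : K[X] := -∏ z ∈ Λ.erase l, (C (algebraMap F K z) - X) ^ a z with hh
  have hfh : f = (X - C (algebraMap F K l)) * h := by
    rw [hf, ← Finset.mul_prod_erase _ _ hl, hal, pow_one, hh]; ring
  have hhl : h.eval (algebraMap F K l) ≠ 0 := by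
    rw [hh, eval_neg, eval_prod, neg_ne_zero, Finset.prod_ne_zero_iff]
    intro z hz
    simp only [eval_pow, eval_sub, eval_C, eval_X]
    refine pow_ne_zero _ (sub_ne_zero.2 fun h => (mem_erase.1 hz).1 ?_)
    exact (algebraMap F K).injective h
  have hfac : ∀ z : K, (C z - X : K[X]) ≠ 0 := by
    intro z hz
    have := congrArg natDegree hz
    rw [← natDegree_neg, neg_sub, natDegree_X_sub_C] at this
    simp at this
  have hf0 : f ≠ 0 := by
    rw [hf, Finset.prod_ne_zero_iff]
    intro z hz
    exact pow_ne_zero _ (hfac _)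
  have hdeg : f.natDegree = m := by
    rw [hf, natDegree_prod _ _ (fun z _ => pow_ne_zero _ (hfac _)), hm]
    refine Finset.sum_congr rfl fun z _ => ?_
    rw [natDegree_pow, ← natDegree_neg, neg_sub, natDegree_X_sub_C, mul_one]
  have hdvd : q - 1 ∣ Q - 1 := by
    rw [hcard]; simpa using Nat.sub_dvd_pow_sub_pow q 1 k
  obtain ⟨e, he⟩ := hdvd
  have hQpos : 0 < Q := Fintype.card_pos
  have hde : (q - 1) * e + 1 = Q := by omega
  have hnorm : ∀ y : K, algebraMap F K (Algebra.norm F y) = y ^ e := by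
    intro y
    rw [FiniteField.algebraMap_norm_eq_pow, Nat.card_eq_fintype_card, Nat.card_eq_fintype_card,
      ← hq, ← hQ, he, Nat.mul_div_cancel_left _ (by omega)]
  let n : F → ℕ := fun b => #{x : K | Algebra.norm F (f.eval x) = b}
  have hsum : ∑ x : K, χ (Algebra.norm F (f.eval x)) = ∑ b, χ b * (n b : ℂ) := by
    rw [← Finset.sum_fiberwise_of_maps_to (s := univ) (t := univ)
      (g := fun x : K => Algebra.norm F (f.eval x)) (fun _ _ => mem_univ _)]
    refine Finset.sum_congr rfl fun b _ => ?_
    rw [Finset.sum_congr rfl (g := fun _ => χ b), Finset.sum_const, nsmul_eq_mul, mul_comm]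
    intro x hx
    rw [(mem_filter.1 hx).2]
  have hsumn : ∑ b, (n b : ℝ) = Q := by
    rw [← Nat.cast_sum]
    congr 1
    rw [hQ, ← card_univ]
    exact (Finset.card_eq_sum_card_fiberwise (fun _ _ => mem_univ _)).symm
  have hU : ∀ b, b ≠ 0 → (n b : ℝ) ≤ (Q : ℝ) / (q - 1 : ℕ) + B * √(Q : ℝ) := by
    intro b hb
    refine le_trans ?_ (hst K hQ0 f h _ (algebraMap F K b) e hfh hhl hdeg hde)
    norm_cast
    refine Finset.card_le_card fun x hx => ?_
    simp only [mem_filter, mem_univ, true_and] at hx ⊢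
    refine ⟨fun h0 => hb ?_, by rw [← hnorm, hx]⟩
    rw [← hx, h0, Algebra.norm_zero]
  have hn0 : n 0 ≤ m := by
    rw [← hdeg]
    refine le_trans ?_ (card_roots' f)
    refine le_trans ?_ (Multiset.toFinset_card_le _)
    refine Finset.card_le_card fun x hx => ?_
    simp only [mem_filter, mem_univ, true_and] at hx
    rw [Multiset.mem_toFinset, mem_roots hf0]
    exact Algebra.norm_eq_zero_iff.1 hx
  rw [hsum]
  refine (char_dist χ hχ n _ hU).trans ?_
  rw [hsumn]
  have hsq : √(Q : ℝ) = √(q : ℝ) ^ k := by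
    rw [hcard]; push_cast
    have h5 : (q : ℝ) ^ k = (√(q : ℝ) ^ k) ^ 2 := by
      rw [← pow_mul, mul_comm, pow_mul, Real.sq_sqrt (by positivity)]
    rw [h5, Real.sqrt_sq (by positivity)]
  rw [← hsq]
  have hq' : ((q - 1 : ℕ) : ℝ) = (q : ℝ) - 1 := by rw [Nat.cast_sub hq1.le]; simp
  have hq'' : ((q : ℝ) - 1) ≠ 0 := by
    have : (1 : ℝ) < q := by exact_mod_cast hq1
    linarith
  rw [hq', mul_add, mul_div_cancel₀ _ hq'']
  have h1 : (1 : ℝ) ≤ √(Q : ℝ) := by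
    rw [Real.one_le_sqrt]; exact_mod_cast hQpos
  have h2 : ((n 0 : ℕ) : ℝ) ≤ m := by exact_mod_cast hn0
  have h3 : (m : ℝ) ≤ m * √(Q : ℝ) := le_mul_of_one_le_right (by positivity) h1
  linarith

open Polynomial in
open Classical in
theorem charφ_sum_zero (F : Type) [Field F] [Fintype F] (χ : MulChar F ℂ) (hχ : χ ≠ 1)
    (Λ : Finset F) (a : F → ℕ) (l : F) (hl : l ∈ Λ) (hal : a l = 1) (n : ℕ) (hn : #Λ ≤ n) :
    ∑ g ∈ monics F n, charφ χ Λ a g = 0 := by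
  set u : F[X] := ∏ z ∈ Λ.erase l, (X - C z) with hu
  set w := u.eval l with hw
  have hw0 : w ≠ 0 := by
    rw [hw, hu, eval_prod, Finset.prod_ne_zero_iff]
    intro z hz
    simp only [eval_sub, eval_X, eval_C]
    exact sub_ne_zero.2 (mem_erase.1 hz).1.symm
  have huz : ∀ z ∈ Λ.erase l, u.eval z = 0 := by
    intro z hz
    rw [hu, eval_prod]
    exact Finset.prod_eq_zero hz (by simp)
  have hudeg : u.natDegree < n := by
    rw [hu, natDegree_prod_of_monic _ _ (fun z _ => monic_X_sub_C z)]
    simp only [natDegree_X_sub_C, Finset.sum_const, smul_eq_mul, mul_one]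
    rw [card_erase_of_mem hl]
    have : 0 < #Λ := card_pos.2 ⟨l, hl⟩
    omega
  have hmem : ∀ c : F, ∀ g ∈ monics F n, g + C c * u ∈ monics F n := by
    intro c g hg
    rw [mem_monics] at hg ⊢
    have hlt : (C c * u).natDegree < g.natDegree := by
      rw [hg.2]; exact (natDegree_C_mul_le _ _).trans_lt hudeg
    have hlt' := degree_lt_degree hlt
    exact ⟨hg.1.add_of_left hlt', by rw [natDegree_add_eq_left_of_natDegree_lt hlt, hg.2]⟩
  have hshift : ∀ c : F, ∑ g ∈ monics F n, charφ χ Λ a (g + C c * u) =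
      ∑ g ∈ monics F n, charφ χ Λ a g := by
    intro c
    refine Finset.sum_bij' (fun g _ => g + C c * u) (fun g _ => g + C (-c) * u)
      (fun g hg => hmem c g hg) (fun g hg => hmem (-c) g hg) ?_ ?_ (fun _ _ => rfl)
    · intro g _; simp
    · intro g _; simp
  have hval : ∀ g : F[X], ∀ c : F, charφ χ Λ a (g + C c * u) =
      χ (g.eval l + c * w) * χ (∏ z ∈ Λ.erase l, g.eval z ^ a z) := by
    intro g c
    change χ (∏ z ∈ Λ, (g + C c * u).eval z ^ a z) = _
    rw [← Finset.mul_prod_erase _ _ hl, hal, pow_one, map_mul]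
    congr 2
    · simp [hw]
    · refine Finset.prod_congr rfl fun z hz => ?_
      simp [huz z hz]
  have hzero : ∑ c : F, ∑ g ∈ monics F n, charφ χ Λ a (g + C c * u) = 0 := by
    rw [Finset.sum_comm]
    refine Finset.sum_eq_zero fun g _ => ?_
    simp only [hval]
    rw [← Finset.sum_mul]
    have : ∑ c : F, χ (g.eval l + c * w) = ∑ b, χ b := by
      refine Fintype.sum_bijective (fun c => g.eval l + c * w) ?_ _ _ (fun _ => rfl)
      exact (Equiv.addLeft (g.eval l)).bijective.comp (mulRight_bijective₀ w hw0)
    rw [this, MulChar.sum_eq_zero_of_ne_one hχ, zero_mul]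
  simp only [hshift] at hzero
  rw [Finset.sum_const, card_univ, nsmul_eq_mul, mul_eq_zero] at hzero
  rcases hzero with h | h
  · exact absurd h (by exact_mod_cast Fintype.card_ne_zero)
  · exact h

open Polynomial in
open Classical in
theorem weil_bound (F : Type) [Field F] [Fintype F] (χ : MulChar F ℂ) (hχ : χ ≠ 1)
    (Λ : Finset F) (a : F → ℕ) (l : F) (hl : l ∈ Λ) (hal : a l = 1) :
    ‖∑ x : F, χ (∏ z ∈ Λ, (z - x) ^ a z)‖ ≤ #Λ * √(Fintype.card F : ℝ) := by
  obtain ⟨B, n0, hB⟩ := ext_bound F χ hχ Λ a l hl hal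
  have h1 := lfun_bound (fun n => ∑ g ∈ monics F n, charφ χ Λ a g) (psumφ (charφ χ Λ a)) (#Λ) n0
    (√(Fintype.card F : ℝ)) B (Real.sqrt_pos.2 (by exact_mod_cast Fintype.card_pos)) ?_ ?_ ?_ hB
  · have h2 := psum_charφ (K := F) χ Λ a
    rw [Module.finrank_self] at h2
    rw [h2] at h1
    convert h1 using 4 with x
    simp [eval_prod]
  · have : monics F 0 = {1} := by
      ext g
      rw [mem_monics, mem_singleton]
      constructor
      · rintro ⟨h1, h2⟩; exact h1.natDegree_eq_zero.1 h2
      · rintro rfl; simp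
    simp [this]
  · intro n hn
    exact charφ_sum_zero F χ hχ Λ a l hl hal n hn.le
  · intro n
    exact newton_poly _ n

/-- `χ` or its conjugate, depending on a sign. -/
noncomputable def sgnchar {F : Type*} [Field F] (χ : MulChar F ℂ) (b : Bool) (y : F) : ℂ :=
  if b then χ y else (starRingEnd ℂ) (χ y)

theorem sgnchar_conj {F : Type*} [Field F] (χ : MulChar F ℂ) (b : Bool) (y : F) :
    (starRingEnd ℂ) (sgnchar χ b y) = sgnchar χ (!b) y := by
  cases b <;> simp [sgnchar]

theorem sgnchar_eq {F : Type*} [Field F] [Fintype F] (hq : 2 < Fintype.card F) (χ : MulChar F ℂ)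
    (b : Bool) (y : F) :
    sgnchar χ b y = χ (y ^ (if b then 1 else Fintype.card F - 2)) := by
  cases b
  · simp only [sgnchar, Bool.false_eq_true, if_false]
    by_cases hy : y = 0
    · rw [hy, zero_pow (by omega), MulChar.map_zero, map_zero]
    · have h1 : χ y * χ (y ^ (Fintype.card F - 2)) = 1 := by
        rw [← map_mul, ← pow_succ', show Fintype.card F - 2 + 1 = Fintype.card F - 1 by omega,
          FiniteField.pow_card_sub_one_eq_one y hy, map_one]
      rw [← Complex.inv_eq_conj (mulchar_norm_eq χ hy)]
      exact inv_eq_of_mul_eq_one_right h1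
  · simp [sgnchar]

theorem sgnchar_norm_le {F : Type*} [Field F] [Fintype F] (χ : MulChar F ℂ) (b : Bool) (y : F) :
    ‖sgnchar χ b y‖ ≤ 1 := by
  cases b <;> simp [sgnchar, mulchar_norm_le]

open Classical in
theorem tuple_bound_true (F : Type) [Field F] [Fintype F] (hq : 2 < Fintype.card F)
    (χ : MulChar F ℂ) (hχ : χ ≠ 1) {ι : Type} [Fintype ι] (s : ι → Bool) (p : ι → F) (i0 : ι)
    (hi0 : ∀ j, p j = p i0 → j = i0) (hs : s i0 = true) :
    ‖∑ x : F, ∏ i, sgnchar χ (s i) (p i - x)‖ ≤ Fintype.card ι * √(Fintype.card F : ℝ) := by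
  let c : ι → ℕ := fun i => if s i then 1 else Fintype.card F - 2
  let a : F → ℕ := fun z => ∑ i with p i = z, c i
  have h1 := weil_bound F χ hχ (univ.image p) a (p i0) (mem_image_of_mem _ (mem_univ _)) (by
    change ∑ i with p i = p i0, c i = 1
    have : (univ.filter fun i => p i = p i0) = {i0} := by
      ext j; simp only [mem_filter, mem_univ, true_and, mem_singleton]
      exact ⟨hi0 j, fun h => by rw [h]⟩
    rw [this, Finset.sum_singleton]; simp [c, hs])
  have h2 : ∀ x : F, χ (∏ z ∈ univ.image p, (z - x) ^ a z) =
      ∏ i, sgnchar χ (s i) (p i - x) := by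
    intro x
    simp only [sgnchar_eq hq]
    rw [← map_prod]
    congr 1
    rw [← Finset.prod_fiberwise_of_maps_to (s := univ) (t := univ.image p) (g := p)
      (fun i _ => mem_image_of_mem _ (mem_univ _))]
    refine Finset.prod_congr rfl fun z _ => ?_
    rw [← Finset.prod_pow_eq_pow_sum]
    refine Finset.prod_congr rfl fun i hi => ?_
    rw [(mem_filter.1 hi).2]
  simp only [h2] at h1
  refine h1.trans ?_
  gcongr
  exact_mod_cast card_image_le

open Classical in
theorem tuple_bound (F : Type) [Field F] [Fintype F] (hq : 2 < Fintype.card F)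
    (χ : MulChar F ℂ) (hχ : χ ≠ 1) {ι : Type} [Fintype ι] (s : ι → Bool) (p : ι → F) (i0 : ι)
    (hi0 : ∀ j, p j = p i0 → j = i0) :
    ‖∑ x : F, ∏ i, sgnchar χ (s i) (p i - x)‖ ≤ Fintype.card ι * √(Fintype.card F : ℝ) := by
  by_cases hs : s i0 = true
  · exact tuple_bound_true F hq χ hχ s p i0 hi0 hs
  · have h1 := tuple_bound_true F hq χ hχ (fun i => !(s i)) p i0 hi0 (by simpa using hs)
    rw [← Complex.norm_conj]
    simpa only [map_sum, map_prod, sgnchar_conj] using h1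

open Classical in
theorem count_tuples {F : Type} {ι : Type} [Fintype ι] (r : ℕ) (hι : Fintype.card ι = 2 * r)
    (hr : 0 < r) (E : Finset F) :
    #{p ∈ Fintype.piFinset (fun _ : ι => E) | ∀ i, ∃ j, p j = p i ∧ j ≠ i} ≤
      r ^ (2 * r) * #E ^ r := by
  have hc : #((univ : Finset (ι → Fin r)) ×ˢ Fintype.piFinset (fun _ : Fin r => E)) =
      r ^ (2 * r) * #E ^ r := by
    rw [card_product, card_univ, Fintype.card_fun, hι, Fintype.card_piFinset]; simp
  rw [← hc]
  refine le_trans (Finset.card_le_card ?_) (Finset.card_image_le (f := fun uv => uv.2 ∘ uv.1))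
  intro p hp
  obtain ⟨hpE, hp2⟩ := mem_filter.1 hp
  rw [Fintype.mem_piFinset] at hpE
  have himg : #(univ.image p) ≤ r := by
    have h1 : 2 * #(univ.image p) ≤ #(univ : Finset ι) := by
      refine Finset.mul_card_image_le_card _ 2 ?_
      intro z hz
      obtain ⟨i, _, rfl⟩ := mem_image.1 hz
      obtain ⟨j, hj, hne⟩ := hp2 i
      exact Finset.one_lt_card.2 ⟨j, by simp [hj], i, by simp, hne⟩
    rw [card_univ, hι] at h1
    omega
  have hne : Nonempty ι := by
    rw [← Fintype.card_pos_iff]; omega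
  obtain ⟨i1⟩ := hne
  haveI : Nonempty {z // z ∈ univ.image p} := ⟨⟨p i1, mem_image_of_mem _ (mem_univ _)⟩⟩
  obtain ⟨e⟩ : Nonempty ({z // z ∈ univ.image p} ↪ Fin r) := by
    refine Function.Embedding.nonempty_of_card_le ?_
    simpa using himg
  refine mem_image.2 ⟨(fun i => e ⟨p i, mem_image_of_mem _ (mem_univ _)⟩,
    fun j => ((Function.invFun e j).1 : F)), ?_, ?_⟩
  · rw [mem_product]
    refine ⟨mem_univ _, Fintype.mem_piFinset.2 fun j => ?_⟩
    obtain ⟨i, _, hi⟩ := mem_image.1 (Function.invFun e j).2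
    change ((Function.invFun e j).1 : F) ∈ E
    rw [← hi]; exact hpE i
  · funext i
    change (Function.invFun e (e ⟨p i, _⟩)).1 = p i
    rw [Function.leftInverse_invFun e.injective]

open Classical in
theorem moment_bound (F : Type) [Field F] [Fintype F] (hq : 2 < Fintype.card F)
    (χ : MulChar F ℂ) (hχ : χ ≠ 1) (E : Finset F) (r : ℕ) (hr : 0 < r) :
    ∑ x : F, ‖∑ l ∈ E, χ (l - x)‖ ^ (2 * r) ≤
      (#E : ℝ) ^ (2 * r) * (2 * r * √(Fintype.card F : ℝ)) +
      (r : ℝ) ^ (2 * r) * (#E : ℝ) ^ r * Fintype.card F := by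
  let ι := Fin r ⊕ Fin r
  let s : ι → Bool := Sum.elim (fun _ => true) (fun _ => false)
  have hι : Fintype.card ι = 2 * r := by simp [ι]; ring
  have h1 : ∀ x : F, ((‖∑ l ∈ E, χ (l - x)‖ ^ (2 * r) : ℝ) : ℂ) =
      ∑ p ∈ Fintype.piFinset (fun _ : ι => E), ∏ i, sgnchar χ (s i) (p i - x) := by
    intro x
    rw [← Finset.prod_univ_sum (t := fun _ : ι => E) (f := fun i l => sgnchar χ (s i) (l - x))]
    rw [Fintype.prod_sum_type]
    simp only [s, Sum.elim_inl, Sum.elim_inr, sgnchar, if_true, Bool.false_eq_true, if_false,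
      Finset.prod_const, card_univ, Fintype.card_fin]
    rw [← map_sum (starRingEnd ℂ), ← mul_pow, Complex.mul_conj, Complex.normSq_eq_norm_sq, pow_mul]
    push_cast; rfl
  have h2 : ((∑ x : F, ‖∑ l ∈ E, χ (l - x)‖ ^ (2 * r) : ℝ) : ℂ) =
      ∑ p ∈ Fintype.piFinset (fun _ : ι => E), ∑ x : F, ∏ i, sgnchar χ (s i) (p i - x) := by
    rw [Finset.sum_comm, ← Finset.sum_congr rfl (fun x _ => h1 x)]; push_cast; rfl
  have h3 : ∑ x : F, ‖∑ l ∈ E, χ (l - x)‖ ^ (2 * r) =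
      ‖∑ p ∈ Fintype.piFinset (fun _ : ι => E), ∑ x : F, ∏ i, sgnchar χ (s i) (p i - x)‖ := by
    rw [← h2, Complex.norm_real, Real.norm_of_nonneg]
    exact Finset.sum_nonneg fun _ _ => by positivity
  rw [h3]
  refine (norm_sum_le _ _).trans ?_
  rw [← Finset.sum_filter_not_add_sum_filter _ (fun p => ∀ i, ∃ j, p j = p i ∧ j ≠ i)]
  refine add_le_add ?_ ?_
  · refine (Finset.sum_le_card_nsmul _ _ (2 * r * √(Fintype.card F : ℝ)) ?_).trans ?_
    · intro p hp
      have hp2 := (mem_filter.1 hp).2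
      push Not at hp2
      obtain ⟨i, hi⟩ := hp2
      have := tuple_bound F hq χ hχ s p i hi
      rw [hι] at this
      push_cast at this
      exact this
    · rw [nsmul_eq_mul]
      gcongr
      refine (Nat.cast_le.2 (card_filter_le _ _)).trans ?_
      rw [Fintype.card_piFinset, Finset.prod_const, card_univ, hι]
      push_cast; rfl
  · refine (Finset.sum_le_card_nsmul _ _ (Fintype.card F : ℝ) ?_).trans ?_
    · intro p _
      refine (norm_sum_le _ _).trans ?_
      refine (Finset.sum_le_card_nsmul _ _ 1 ?_).trans (by simp)
      intro x _
      rw [norm_prod]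
      exact Finset.prod_le_one (fun _ _ => norm_nonneg _) (fun _ _ => sgnchar_norm_le _ _ _)
    · rw [nsmul_eq_mul]
      gcongr
      have h4 := count_tuples (ι := ι) r hι hr E
      have h5 : ((#{p ∈ Fintype.piFinset (fun _ : ι => E) | ∀ i, ∃ j, p j = p i ∧ j ≠ i} : ℕ) : ℝ) ≤
        ((r ^ (2 * r) * #E ^ r : ℕ) : ℝ) := by
        refine Nat.cast_le.2 ?_
        convert h4
      push_cast at h5
      exact h5

noncomputable instance mulcharFintype (F : Type) [Field F] [Fintype F] : Fintype (MulChar F ℂ) :=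
  Fintype.ofFinite _

theorem mulchar_card (F : Type) [Field F] [Fintype F] :
    Fintype.card (MulChar F ℂ) = Fintype.card F - 1 := by
  rw [← Nat.card_eq_fintype_card, MulChar.card_eq_card_units_of_hasEnoughRootsOfUnity,
    Nat.card_units, Nat.card_eq_fintype_card]

theorem mulchar_sum_zero (F : Type) [Field F] [Fintype F] (y : F) (hy : y ≠ 1) :
    ∑ χ : MulChar F ℂ, χ y = 0 := by
  obtain ⟨χ, hχ⟩ := MulChar.exists_apply_ne_one_of_hasEnoughRootsOfUnity F ℂ hy
  refine eq_zero_of_mul_eq_self_left hχ ?_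
  simp only [Finset.mul_sum, ← MulChar.mul_apply]
  exact Fintype.sum_bijective _ (Group.mulLeft_bijective χ) _ _ fun χ' ↦ rfl

open Classical in
theorem mulchar_parseval (F : Type) [Field F] [Fintype F] (G : Finset F) (hG : (0 : F) ∉ G) :
    ∑ χ : MulChar F ℂ, ‖∑ g ∈ G, χ g⁻¹‖ ^ 2 = ((Fintype.card F : ℝ) - 1) * #G := by
  have hne : ∀ g ∈ G, g ≠ 0 := fun g hg h => hG (h ▸ hg)
  have hconj : ∀ χ : MulChar F ℂ, ∀ g ∈ G, (starRingEnd ℂ) (χ g⁻¹) = χ g := by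
    intro χ g hg
    rw [← Complex.inv_eq_conj (mulchar_norm_eq χ (inv_ne_zero (hne g hg)))]
    refine inv_eq_of_mul_eq_one_right ?_
    rw [← map_mul, inv_mul_cancel₀ (hne g hg), map_one]
  have h1 : ∀ χ : MulChar F ℂ, ((‖∑ g ∈ G, χ g⁻¹‖ ^ 2 : ℝ) : ℂ) =
      ∑ g ∈ G, ∑ g' ∈ G, χ (g⁻¹ * g') := by
    intro χ
    rw [← Complex.normSq_eq_norm_sq, ← Complex.mul_conj, map_sum, Finset.sum_mul_sum]
    refine Finset.sum_congr rfl fun g _ => Finset.sum_congr rfl fun g' hg' => ?_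
    rw [hconj χ g' hg', map_mul]
  have h2 : ((∑ χ : MulChar F ℂ, ‖∑ g ∈ G, χ g⁻¹‖ ^ 2 : ℝ) : ℂ) =
      ((((Fintype.card F : ℝ) - 1) * #G : ℝ) : ℂ) := by
    rw [Complex.ofReal_sum, Finset.sum_congr rfl (fun χ _ => h1 χ), Finset.sum_comm]
    have h3 : ∀ g ∈ G, ∑ χ : MulChar F ℂ, ∑ g' ∈ G, χ (g⁻¹ * g') = (Fintype.card F : ℂ) - 1 := by
      intro g hg
      rw [Finset.sum_comm, Finset.sum_eq_single g]
      · rw [inv_mul_cancel₀ (hne g hg)]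
        simp only [map_one, Finset.sum_const, card_univ, mulchar_card, nsmul_eq_mul, mul_one]
        rw [Nat.cast_sub Fintype.card_pos]; simp
      · intro g' hg' hgg
        refine mulchar_sum_zero F _ fun h => hgg ?_
        field_simp [hne g hg] at h
        exact h
      · exact fun h => absurd hg h
    rw [Finset.sum_congr rfl h3, Finset.sum_const, nsmul_eq_mul]
    push_cast; ring
  exact_mod_cast h2

open Classical in
theorem orth_bound (F : Type) [Field F] [Fintype F] (E F' G H : Finset F)
    (hG : (0 : F) ∉ G) (hH : (0 : F) ∉ H)
    (hE : ∀ l ∈ E, ∀ f ∈ F', ∀ g ∈ G, ∀ h ∈ H, f + g * h ≠ l) (hF' : 1 ≤ #F')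
    (M : ℝ) (hM0 : 0 ≤ M) (hM : ∀ χ : MulChar F ℂ, χ ≠ 1 → ‖∑ f ∈ F', ∑ l ∈ E, χ (l - f)‖ ≤ M) :
    ((#E : ℝ) * (#F' - 1)) ^ 2 * (#G * #H) ≤ M ^ 2 * (Fintype.card F : ℝ) ^ 2 := by
  have hneG : ∀ g ∈ G, g ≠ 0 := fun g hg h => hG (h ▸ hg)
  have hneH : ∀ g ∈ H, g ≠ 0 := fun g hg h => hH (h ▸ hg)
  let S : MulChar F ℂ → ℂ := fun χ => ∑ f ∈ F', ∑ l ∈ E, χ (l - f)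
  let Gh : MulChar F ℂ → ℂ := fun χ => ∑ g ∈ G, χ g⁻¹
  let Hh : MulChar F ℂ → ℂ := fun χ => ∑ h ∈ H, χ h⁻¹
  have h1 : ∑ χ : MulChar F ℂ, S χ * (Gh χ * Hh χ) = 0 := by
    have h2 : ∀ χ : MulChar F ℂ, S χ * (Gh χ * Hh χ) =
        ∑ f ∈ F', ∑ l ∈ E, ∑ g ∈ G, ∑ h ∈ H, χ ((l - f) * (g⁻¹ * h⁻¹)) := by
      intro χ
      have h2 : Gh χ * Hh χ = ∑ g ∈ G, ∑ h ∈ H, χ g⁻¹ * χ h⁻¹ := Finset.sum_mul_sum _ _ _ _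
      rw [h2]
      simp only [S, map_mul]
      rw [Finset.sum_mul]
      refine Finset.sum_congr rfl fun f _ => ?_
      rw [Finset.sum_mul]
      refine Finset.sum_congr rfl fun l _ => ?_
      rw [Finset.mul_sum]
      refine Finset.sum_congr rfl fun g _ => ?_
      rw [Finset.mul_sum]
    rw [Finset.sum_congr rfl (fun χ _ => h2 χ), Finset.sum_comm]
    refine Finset.sum_eq_zero fun f hf => ?_
    rw [Finset.sum_comm]
    refine Finset.sum_eq_zero fun l hl => ?_
    rw [Finset.sum_comm]
    refine Finset.sum_eq_zero fun g hg => ?_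
    rw [Finset.sum_comm]
    refine Finset.sum_eq_zero fun h hh => ?_
    refine mulchar_sum_zero F _ fun heq => hE l hl f hf g hg h hh ?_
    have hg0 := hneG g hg
    have hh0 := hneH h hh
    field_simp at heq
    rw [← heq]; ring
  rw [← Finset.add_sum_erase _ _ (mem_univ (1 : MulChar F ℂ))] at h1
  have hS1 : (#E : ℝ) * (#F' - 1) ≤ ‖S 1‖ := by
    have h2 : S 1 = ((∑ l ∈ E, #(F'.erase l) : ℕ) : ℂ) := by
      simp only [S]
      rw [Finset.sum_comm]
      push_cast
      refine Finset.sum_congr rfl fun l _ => ?_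
      rw [← Finset.sum_subset (Finset.erase_subset l F')]
      · rw [Finset.card_eq_sum_ones, Nat.cast_sum]
        refine Finset.sum_congr rfl fun f hf => ?_
        have : l - f ≠ 0 := sub_ne_zero.2 (mem_erase.1 hf).1.symm
        rw [MulChar.one_apply (IsUnit.mk0 _ this)]; simp
      · intro f hf hf'
        have : f = l := by
          by_contra h; exact hf' (mem_erase.2 ⟨h, hf⟩)
        rw [this, sub_self, MulChar.map_zero]
    rw [h2, Complex.norm_natCast]
    push_cast
    rw [← nsmul_eq_mul]
    refine Finset.card_nsmul_le_sum _ _ _ fun l _ => ?_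
    have := Finset.pred_card_le_card_erase (s := F') (a := l)
    have h3 : ((#F' - 1 : ℕ) : ℝ) ≤ #(F'.erase l) := by exact_mod_cast this
    rw [Nat.cast_sub hF'] at h3
    simpa using h3
  have hone : ∀ T : Finset F, (0 : F) ∉ T → ∑ g ∈ T, (1 : MulChar F ℂ) g⁻¹ = #T := by
    intro T hT
    rw [Finset.card_eq_sum_ones, Nat.cast_sum]
    refine Finset.sum_congr rfl fun g hg => ?_
    have : g⁻¹ ≠ 0 := inv_ne_zero fun h => hT (h ▸ hg)
    rw [MulChar.one_apply (IsUnit.mk0 _ this)]; simp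
  have hq1 : (1 : ℝ) ≤ Fintype.card F := by exact_mod_cast Fintype.card_pos
  have hF1 : (1 : ℝ) ≤ #F' := by exact_mod_cast hF'
  have h4 : ‖S 1‖ * (#G * #H) ≤ M * ∑ χ : MulChar F ℂ, ‖Gh χ‖ * ‖Hh χ‖ := by
    have h5 : ‖S 1‖ * (#G * #H) = ‖∑ χ ∈ univ.erase (1 : MulChar F ℂ), S χ * (Gh χ * Hh χ)‖ := by
      rw [← norm_neg (∑ χ ∈ univ.erase (1 : MulChar F ℂ), S χ * (Gh χ * Hh χ)),
        ← eq_neg_of_add_eq_zero_left h1, norm_mul, norm_mul]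
      simp only [Gh, Hh]
      rw [hone G hG, hone H hH, Complex.norm_natCast, Complex.norm_natCast]
    rw [h5, Finset.mul_sum]
    refine (norm_sum_le _ _).trans ?_
    refine le_trans (Finset.sum_le_sum (g := fun χ => M * (‖Gh χ‖ * ‖Hh χ‖)) fun χ hχ => ?_)
      (Finset.sum_le_sum_of_subset_of_nonneg (Finset.erase_subset _ _)
        fun _ _ _ => by positivity)
    rw [norm_mul, norm_mul]
    gcongr
    exact hM χ (mem_erase.1 hχ).1
  have h6 : (∑ χ : MulChar F ℂ, ‖Gh χ‖ * ‖Hh χ‖) ^ 2 ≤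
      (Fintype.card F : ℝ) ^ 2 * (#G * #H) := by
    refine (Finset.sum_mul_sq_le_sq_mul_sq _ _ _).trans ?_
    simp only [Gh, Hh]
    rw [mulchar_parseval F G hG, mulchar_parseval F H hH]
    have h7 : ((Fintype.card F : ℝ) - 1) ^ 2 ≤ (Fintype.card F : ℝ) ^ 2 := by
      gcongr
      linarith
    have h8 : (0 : ℝ) ≤ #G * #H := by positivity
    nlinarith [mul_le_mul_of_nonneg_right h7 h8]
  set P : ℝ := #G * #H with hP
  have hP0 : 0 ≤ P := by positivity
  rcases hP0.eq_or_lt with h0 | hpos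
  · rw [← h0, mul_zero]; positivity
  have hX0 : 0 ≤ (#E : ℝ) * (#F' - 1) := mul_nonneg (by positivity) (by linarith)
  have h9 : ((#E : ℝ) * (#F' - 1) * P) ^ 2 ≤ M ^ 2 * ((Fintype.card F : ℝ) ^ 2 * P) := by
    calc ((#E : ℝ) * (#F' - 1) * P) ^ 2 ≤ (‖S 1‖ * P) ^ 2 := by gcongr
      _ ≤ (M * ∑ χ : MulChar F ℂ, ‖Gh χ‖ * ‖Hh χ‖) ^ 2 := by gcongr
      _ = M ^ 2 * (∑ χ : MulChar F ℂ, ‖Gh χ‖ * ‖Hh χ‖) ^ 2 := by ring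
      _ ≤ _ := by gcongr
  refine le_of_mul_le_mul_right ?_ hpos
  calc _ = ((#E : ℝ) * (#F' - 1) * P) ^ 2 := by ring
    _ ≤ _ := h9
    _ = _ := by ring

open Classical in
theorem combined_bound (F : Type) [Field F] [Fintype F] (hq : 2 < Fintype.card F)
    (E F' G H : Finset F) (hG : (0 : F) ∉ G) (hH : (0 : F) ∉ H)
    (hE : ∀ l ∈ E, ∀ f ∈ F', ∀ g ∈ G, ∀ h ∈ H, f + g * h ≠ l) (hF' : 1 ≤ #F') (r : ℕ)
    (hr : 0 < r) :
    ((#E : ℝ) * (#F' - 1)) ^ (2 * r) * (#G * #H) ^ r ≤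
      ((#F' : ℝ) ^ (2 * r - 1) * ((#E : ℝ) ^ (2 * r) * (2 * r * √(Fintype.card F : ℝ)) +
      (r : ℝ) ^ (2 * r) * (#E : ℝ) ^ r * Fintype.card F)) * (Fintype.card F : ℝ) ^ (2 * r) := by
  set X : ℝ := (#F' : ℝ) ^ (2 * r - 1) * ((#E : ℝ) ^ (2 * r) * (2 * r * √(Fintype.card F : ℝ)) +
      (r : ℝ) ^ (2 * r) * (#E : ℝ) ^ r * Fintype.card F) with hX
  have hX0 : 0 ≤ X := by positivity
  have h2r : 2 * r ≠ 0 := by omega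
  set M : ℝ := X ^ (((2 * r : ℕ) : ℝ)⁻¹) with hM
  have hM0 : 0 ≤ M := Real.rpow_nonneg hX0 _
  have hMX : M ^ (2 * r) = X := Real.rpow_inv_natCast_pow hX0 h2r
  have hF1 : (0 : ℝ) < #F' := by exact_mod_cast hF'
  have h1 := orth_bound F E F' G H hG hH hE hF' M hM0 (by
    intro χ hχ
    refine le_of_pow_le_pow_left₀ h2r hM0 ?_
    rw [hMX]
    have h2 := pow_sum_div_card_le_sum_pow (s := F') (f := fun f => ‖∑ l ∈ E, χ (l - f)‖)
      (fun _ _ => norm_nonneg _) (2 * r - 1)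
    rw [show 2 * r - 1 + 1 = 2 * r by omega, div_le_iff₀' (by positivity)] at h2
    calc _ ≤ (∑ f ∈ F', ‖∑ l ∈ E, χ (l - f)‖) ^ (2 * r) := by
          gcongr; exact norm_sum_le _ _
      _ ≤ _ := h2
      _ ≤ (#F' : ℝ) ^ (2 * r - 1) * ∑ f : F, ‖∑ l ∈ E, χ (l - f)‖ ^ (2 * r) := by
          gcongr
          exact Finset.subset_univ _
      _ ≤ X := by
          rw [hX]
          gcongr
          exact moment_bound F hq χ hχ E r hr)
  have h3 := pow_le_pow_left₀ (by positivity) h1 r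
  rw [mul_pow _ ((#G : ℝ) * #H) r, mul_pow (M ^ 2), ← pow_mul, ← pow_mul, ← pow_mul, hMX] at h3
  exact h3

theorem final_arith (ε δ q e f P : ℝ) (r : ℕ) (hr : 0 < r) (hrε : 1 ≤ ε * r)
    (hδ : δ * r ≤ ε / 2) (hq : 1 ≤ q) (he : q ^ ε < e) (hf : q ^ ((1 : ℝ) / 2 + ε) ≤ f) (hf2 : 2 ≤ f)
    (hP : q ^ (2 - δ) / 4 ≤ P)
    (h : (e * (f - 1)) ^ (2 * r) * P ^ r ≤
      (f ^ (2 * r - 1) * (e ^ (2 * r) * (2 * r * √q) + (r : ℝ) ^ (2 * r) * e ^ r * q)) *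
        q ^ (2 * r)) :
    q ^ (ε / 2) ≤ 16 ^ r * (2 * r + (r : ℝ) ^ (2 * r)) := by
  have hq0 : 0 < q := by linarith
  have he0 : 0 < e := (Real.rpow_pos_of_pos hq0 _).trans he
  have hf0 : 0 < f := by linarith
  set C0 : ℝ := 2 * r + (r : ℝ) ^ (2 * r) with hC0
  have hsq1 : 1 ≤ √q := Real.one_le_sqrt.2 hq
  have hqe : q ≤ e ^ r := by
    calc q = q ^ (1 : ℝ) := (Real.rpow_one q).symm
      _ ≤ q ^ (ε * r) := Real.rpow_le_rpow_of_exponent_le hq hrε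
      _ = (q ^ ε) ^ r := by rw [Real.rpow_mul hq0.le, Real.rpow_natCast]
      _ ≤ e ^ r := by gcongr
  have h1 : e ^ (2 * r) * (2 * r * √q) + (r : ℝ) ^ (2 * r) * e ^ r * q ≤
      e ^ (2 * r) * (√q * C0) := by
    have h2 : (r : ℝ) ^ (2 * r) * e ^ r * q ≤ (r : ℝ) ^ (2 * r) * e ^ r * e ^ r * √q := by
      calc (r : ℝ) ^ (2 * r) * e ^ r * q ≤ (r : ℝ) ^ (2 * r) * e ^ r * e ^ r := by gcongr
        _ ≤ _ := le_mul_of_one_le_right (by positivity) hsq1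
    have h3 : e ^ (2 * r) = e ^ r * e ^ r := by rw [two_mul, pow_add]
    rw [hC0, h3]; linarith
  have h2 : e ^ (2 * r) * f ^ (2 * r) * ((q ^ (2 - δ)) ^ r / 16 ^ r) ≤
      (e * (f - 1)) ^ (2 * r) * P ^ r := by
    calc e ^ (2 * r) * f ^ (2 * r) * ((q ^ (2 - δ)) ^ r / 16 ^ r) =
        (e * (f / 2)) ^ (2 * r) * (q ^ (2 - δ) / 4) ^ r := by
          rw [mul_pow, div_pow, div_pow, pow_mul 2, show (16 : ℝ) = 2 ^ 2 * 4 by norm_num, mul_pow]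
          field_simp
      _ ≤ _ := by
          have hf1 : f / 2 ≤ f - 1 := by linarith
          have h0 : 0 ≤ (e * (f - 1)) ^ (2 * r) :=
            pow_nonneg (mul_nonneg he0.le (by linarith)) _
          gcongr
  have h3 : e ^ (2 * r) * f ^ (2 * r) * ((q ^ (2 - δ)) ^ r / 16 ^ r) ≤
      (f ^ (2 * r - 1) * (e ^ (2 * r) * (√q * C0))) * q ^ (2 * r) :=
    h2.trans (h.trans (by gcongr))
  have hf' : f ^ (2 * r) = f ^ (2 * r - 1) * f := by
    rw [← pow_succ]; congr 1; omega
  rw [hf'] at h3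
  have h4 : f * ((q ^ (2 - δ)) ^ r / 16 ^ r) ≤ √q * C0 * q ^ (2 * r) := by
    have hpos : 0 < e ^ (2 * r) * f ^ (2 * r - 1) := by positivity
    refine le_of_mul_le_mul_left ?_ hpos
    linarith
  have h5 : √q * q ^ (2 * r) * q ^ (ε / 2) ≤ f * (q ^ (2 - δ)) ^ r := by
    calc √q * q ^ (2 * r) * q ^ (ε / 2) = q ^ ((1 : ℝ) / 2 + (2 * r : ℕ) + ε / 2) := by
          rw [Real.rpow_add hq0, Real.rpow_add hq0, Real.rpow_natCast, Real.sqrt_eq_rpow]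
      _ ≤ q ^ (((1 : ℝ) / 2 + ε) + (2 - δ) * r) := by
          refine Real.rpow_le_rpow_of_exponent_le hq ?_
          push_cast; linarith
      _ = q ^ ((1 : ℝ) / 2 + ε) * (q ^ (2 - δ)) ^ r := by
          rw [Real.rpow_add hq0, Real.rpow_mul hq0.le, Real.rpow_natCast]
      _ ≤ _ := by gcongr
  have hpos : 0 < √q * q ^ (2 * r) := by positivity
  refine le_of_mul_le_mul_left ?_ hpos
  rw [← mul_div_assoc, div_le_iff₀ (by positivity)] at h4
  linarith

theorem half_card_erase {F : Type*} [DecidableEq F] (G : Finset F) (x : F) (hG : (2 : ℝ) ≤ #G) :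
    (#G : ℝ) / 2 ≤ #(G.erase x) := by
  have h1 := Finset.pred_card_le_card_erase (s := G) (a := x)
  have h2 : (2 : ℕ) ≤ #G := by exact_mod_cast hG
  have h3 : ((#G - 1 : ℕ) : ℝ) ≤ #(G.erase x) := by exact_mod_cast h1
  rw [Nat.cast_sub (by omega)] at h3
  push_cast at h3
  linarith

theorem two_le_card_of_mul {q δ g h : ℝ} (hq : 4 ≤ q) (hδ : δ ≤ 1 / 2)
    (hh : h ≤ q) (hg0 : 0 ≤ g) (hgh : q ^ (2 - δ) ≤ g * h) : 2 ≤ g := by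
  have hq0 : 0 < q := by linarith
  have h1 : q * 2 ≤ q ^ (2 - δ) := by
    calc q * 2 ≤ q * √q := by
          gcongr
          exact Real.le_sqrt_of_sq_le (by linarith)
      _ = q ^ ((1 : ℝ) + 1 / 2) := by rw [Real.rpow_add hq0, Real.rpow_one, Real.sqrt_eq_rpow]
      _ ≤ _ := Real.rpow_le_rpow_of_exponent_le (by linarith) (by linarith)
  have h2 : g * h ≤ g * q := by gcongr
  refine le_of_mul_le_mul_left ?_ hq0
  linarith

/-- Corollary 3: for every `ε > 0` there exists `δ > 0` such that for all sufficiently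
large finite fields `F` with `q` elements and all sets `F', G, H ⊆ F` with
`|F'| ≥ q^{1/2+ε}` and `|G||H| ≥ q^{2-δ}`, the set of `λ` for which `f + gh = λ` has no
solution has `O(q^ε)` elements. -/
theorem exceptional_set_eps (ε : ℝ) (hε : 0 < ε) :
    ∃ δ : ℝ, 0 < δ ∧ ∃ K : ℝ, 0 < K ∧ ∃ Q : ℕ,
      ∀ (F : Type) [Field F] [Fintype F] [DecidableEq F],
        Q ≤ Fintype.card F →
        ∀ (F' G H : Finset F),
          (F'.card : ℝ) ≥ (Fintype.card F : ℝ) ^ ((1 : ℝ) / 2 + ε) →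
          (G.card * H.card : ℝ) ≥ (Fintype.card F : ℝ) ^ ((2 : ℝ) - δ) →
          ((Finset.univ.filter
              (fun lam : F => ∀ f ∈ F', ∀ g ∈ G, ∀ h ∈ H, f + g * h ≠ lam)).card : ℝ) ≤
            K * (Fintype.card F : ℝ) ^ (ε : ℝ) := by
  set r : ℕ := ⌈1 / ε⌉₊ with hr
  have hr0 : 0 < r := Nat.ceil_pos.2 (by positivity)
  have hr0' : (0 : ℝ) < r := by exact_mod_cast hr0
  have hrε : 1 ≤ ε * r := by
    have h1 : 1 / ε ≤ r := Nat.le_ceil _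
    rw [div_le_iff₀ hε] at h1
    linarith
  set C : ℝ := 16 ^ r * (2 * r + (r : ℝ) ^ (2 * r)) with hC
  have hC0 : 0 < C := by positivity
  set δ : ℝ := min (ε / (2 * r)) (1 / 2) with hδ
  have hδr : δ * r ≤ ε / 2 := by
    calc δ * r ≤ ε / (2 * r) * r := by gcongr; exact min_le_left _ _
      _ = ε / 2 := by field_simp
  refine ⟨δ, lt_min (by positivity) (by norm_num), 1, one_pos, ⌈C ^ (2 / ε)⌉₊ + 4, ?_⟩
  intro F _ _ _ hQ F' G H hF' hGH
  by_contra hcon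
  push Not at hcon
  rw [one_mul] at hcon
  set E := Finset.univ.filter (fun lam : F => ∀ f ∈ F', ∀ g ∈ G, ∀ h ∈ H, f + g * h ≠ lam) with hE
  set q : ℝ := ((Fintype.card F : ℕ) : ℝ) with hq
  have hq4 : (4 : ℝ) ≤ q := by
    have : 4 ≤ Fintype.card F := by omega
    rw [hq]
    exact_mod_cast this
  have hqC : C ^ (2 / ε) < q := by
    have h1 : ⌈C ^ (2 / ε)⌉₊ < Fintype.card F := by omega
    have h2 : (⌈C ^ (2 / ε)⌉₊ : ℝ) < q := by rw [hq]; exact_mod_cast h1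
    exact (Nat.le_ceil _).trans_lt h2
  have hδ2 : δ ≤ 1 / 2 := min_le_right _ _
  have hcG : (#G : ℝ) ≤ q := by rw [hq]; exact_mod_cast Finset.card_le_univ G
  have hcH : (#H : ℝ) ≤ q := by rw [hq]; exact_mod_cast Finset.card_le_univ H
  have hG2 : (2 : ℝ) ≤ #G := two_le_card_of_mul hq4 hδ2 hcH (by positivity) hGH
  have hH2 : (2 : ℝ) ≤ #H :=
    two_le_card_of_mul hq4 hδ2 hcG (by positivity) (by rw [mul_comm]; exact hGH)
  have hF2 : (2 : ℝ) ≤ #F' := by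
    refine le_trans ?_ hF'
    calc (2 : ℝ) ≤ √q := Real.le_sqrt_of_sq_le (by linarith)
      _ = q ^ ((1 : ℝ) / 2) := Real.sqrt_eq_rpow q
      _ ≤ _ := Real.rpow_le_rpow_of_exponent_le (by linarith) (by linarith)
  have hP : q ^ (2 - δ) / 4 ≤ (#(G.erase 0) : ℝ) * #(H.erase 0) := by
    calc q ^ (2 - δ) / 4 ≤ (#G * #H : ℝ) / 4 := by gcongr
      _ = (#G / 2 : ℝ) * (#H / 2) := by ring
      _ ≤ _ := by
        gcongr
        · exact half_card_erase G 0 hG2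
        · exact half_card_erase H 0 hH2
  have hmain := combined_bound F (by omega) E F' (G.erase 0) (H.erase 0) (by simp) (by simp)
    (fun l hl f hf g hg h hh => (mem_filter.1 hl).2 f hf g (mem_of_mem_erase hg) h
      (mem_of_mem_erase hh)) (by
        have : 2 ≤ #F' := by exact_mod_cast hF2
        omega) r hr0
  have hfin := final_arith ε δ q (#E) (#F') _ r hr0 hrε hδr (by linarith) hcon hF' hF2 hP hmain
  have h1 : C < q ^ (ε / 2) := by
    have h2 := Real.rpow_lt_rpow (by positivity) hqC (half_pos hε)
    rw [← Real.rpow_mul hC0.le, show 2 / ε * (ε / 2) = 1 by field_simp, Real.rpow_one] at h2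
    exact h2
  linarith
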